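/- arXiv:math/0403406 — 2 statements merged into one kernel-verified Lean document; each statement's English description precedes it below -/
import Mathlib

section
/- Let h be a Brouwer homeomorphism and let D, V be closed topological disks with free interiors. Then the set of integers n such that h^n(Int D) meets Int V is an interval of ℤ (i.e. if it contains m and m' with m ≤ m', it contains every integer between m and m'). -/
open Set Filter Topology

/-- The plane. -/
abbrev Plane : Type := ℝ × ℝ

/-- A homeomorphism of the plane preserves orientation iff it is isotopic to the identity. -/
def IsotopicToId (h : Plane ≃ₜ Plane) : Prop :=
  ∃ H : ℝ → Plane ≃ₜ Plane,
    Continuous (fun p : ℝ × Plane => H p.1 p.2) ∧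
    H 0 = Homeomorph.refl Plane ∧ H 1 = h

/-- A Brouwer homeomorphism: an orientation-preserving (i.e. isotopic to the identity),
fixed-point-free homeomorphism of the plane. -/
structure BrouwerHomeo where
  toHomeomorph : Plane ≃ₜ Plane
  orientationPreserving : IsotopicToId toHomeomorph
  fixedPointFree : ∀ x : Plane, toHomeomorph x ≠ x

/-- The integer iterate `h^n`. -/
def BrouwerHomeo.iter (h : BrouwerHomeo) (n : ℤ) : Plane → Plane :=
  ⇑(h.toHomeomorph.toEquiv ^ n)

/-- A set is free if it is disjoint from its image under `h`. -/
def IsFree (h : BrouwerHomeo) (E : Set Plane) : Prop :=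
  Disjoint (h.toHomeomorph '' E) E

/-- A closed topological disk: a subset of the plane homeomorphic to the closed unit disk. -/
def IsClosedDisk (D : Set Plane) : Prop :=
  Nonempty (D ≃ₜ (Metric.closedBall (0 : Plane) 1 : Set Plane))

section

open scoped unitInterval

theorem exists_log_homotopy {A : Type*} [TopologicalSpace A] {F : I × A → ℂ} (hF : Continuous F)
    (hF0 : ∀ x, F x ≠ 0) {l : A → ℂ} (hl : Continuous l) (h0 : ∀ a, F (0, a) = Complex.exp (l a)) :
    ∃ L : I × A → ℂ, Continuous L ∧ (∀ x, Complex.exp (L x) = F x) ∧ ∀ a, L (0, a) = l a := by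
  let G : C(I × A, {z : ℂ // z ≠ 0}) := ⟨fun x => ⟨F x, hF0 x⟩, hF.subtype_mk _⟩
  have hG : ∀ a, G (0, a) = ⟨_, (l a).exp_ne_zero⟩ := fun a => Subtype.ext (h0 a)
  refine ⟨Complex.isCoveringMap_exp.liftHomotopy G ⟨l, hl⟩ hG, ContinuousMap.continuous _,
    fun x => ?_, fun a => Complex.isCoveringMap_exp.liftHomotopy_zero G ⟨l, hl⟩ hG a⟩
  exact congrArg Subtype.val
    (congrFun (Complex.isCoveringMap_exp.liftHomotopy_lifts G ⟨l, hl⟩ hG) x)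

theorem exists_log_of_ne_zero {F : ℂ → ℂ} (hF : Continuous F) (hF0 : ∀ z, F z ≠ 0) :
    ∃ L : ℂ → ℂ, Continuous L ∧ ∀ z, Complex.exp (L z) = F z := by
  obtain ⟨L, hL, hexp, -⟩ := exists_log_homotopy (A := ℂ) (F := fun x => F ((x.1 : ℝ) * x.2))
    (by fun_prop) (fun x => hF0 _) (l := fun _ => Complex.log (F 0)) continuous_const
    (fun a => by simp [Complex.exp_log (hF0 0)])
  exact ⟨fun z => L (1, z), by fun_prop, fun z => by simp [hexp]⟩

theorem eqOn_of_exp_eq {A : Type*} [TopologicalSpace A] {S : Set A} (hS : IsPreconnected S)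
    {g : A → ℂ} (hg : ContinuousOn g S)
    (h : ∀ x ∈ S, ∀ y ∈ S, Complex.exp (g x) = Complex.exp (g y)) {x y : A} (hx : x ∈ S)
    (hy : y ∈ S) : g x = g y := by
  have := isPreconnected_iff_preconnectedSpace.1 hS
  have sep : IsSeparatedMap fun z : ℂ => (⟨_, z.exp_ne_zero⟩ : {z : ℂ // z ≠ 0}) :=
    Complex.isCoveringMap_exp.isSeparatedMap
  exact sep.const_of_comp (A := S) Complex.isCoveringMap_exp.isLocalHomeomorph.isLocallyInjective
    hg.domRestrict (fun a b => Subtype.ext (h a a.2 b b.2)) ⟨x, hx⟩ ⟨y, hy⟩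

theorem one_add_exp_mem_slitPlane {u : ℂ} (hu : u.re < 0) : 1 + Complex.exp u ∈ Complex.slitPlane := by
  apply Complex.mem_slitPlane_of_norm_lt_one
  rwa [Complex.norm_exp, Real.exp_lt_one_iff]

/-- A lift to the universal cover of a degree one self-map of the punctured plane fixing both
ends takes a value projecting to `-1`. -/
theorem exists_exp_eq_neg_one {u : ℂ → ℂ} (hu : Continuous u)
    (hper : ∀ z, u (z + 2 * Real.pi * Complex.I) = u z + 2 * Real.pi * Complex.I) {a b : ℝ}
    (ha : ∀ z : ℂ, z.re = a → (u z).re < 0) (hb : ∀ z : ℂ, z.re = b → 0 < (u z).re) :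
    ∃ z, Complex.exp (u z) = -1 := by
  by_contra! hne
  have hne' : ∀ z, 1 + Complex.exp (u z) ≠ 0 := fun z hz => hne z (by linear_combination hz)
  obtain ⟨l, hl, hexp⟩ := exists_log_of_ne_zero (F := fun z => 1 + Complex.exp (u z))
    (by fun_prop) hne'
  set c : ℂ := 2 * Real.pi * Complex.I with hc
  have hexpc : Complex.exp c = 1 := Complex.exp_two_pi_mul_I
  have hcre : c.re = 0 := by simp [hc]
  have hline : ∀ r : ℝ, IsPreconnected {z : ℂ | z.re = r} := fun r =>
    (convex_hyperplane Complex.reLm.isLinear r).isPreconnected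
  have hd : l (a + c) - l a = l (b + c) - l b := by
    refine eqOn_of_exp_eq (g := fun z => l (z + c) - l z) isPreconnected_univ
      (by fun_prop) (fun x _ y _ => ?_) (mem_univ (a : ℂ)) (mem_univ (b : ℂ))
    simp [Complex.exp_sub, hexp, hper, Complex.exp_add, hexpc, hne']
  have hA : l (a + c) - l a = 0 := by
    have := eqOn_of_exp_eq (g := fun z => l z - Complex.log (1 + Complex.exp (u z))) (hline a)
      (by
        refine hl.continuousOn.sub (ContinuousOn.clog (by fun_prop) fun z hz => ?_)
        exact one_add_exp_mem_slitPlane (ha z hz))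
      (fun x hx y hy => by
        have hx0 := Complex.slitPlane_ne_zero (one_add_exp_mem_slitPlane (ha x hx))
        have hy0 := Complex.slitPlane_ne_zero (one_add_exp_mem_slitPlane (ha y hy))
        simp [Complex.exp_sub, hexp, Complex.exp_log hx0, Complex.exp_log hy0, hx0, hy0])
      (x := a + c) (y := a) (by simp [hcre]) (by simp)
    simp only [hper, Complex.exp_add, hexpc, mul_one] at this
    linear_combination this
  have hB : l (b + c) - l b = c := by
    have hneg : ∀ z : ℂ, z.re = b → 1 + Complex.exp (-u z) ∈ Complex.slitPlane := fun z hz =>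
      one_add_exp_mem_slitPlane (by simpa using hb z hz)
    have hval : ∀ z : ℂ, z.re = b →
        Complex.exp (l z - u z - Complex.log (1 + Complex.exp (-u z))) = 1 := fun z hz => by
      have h0 := Complex.slitPlane_ne_zero (hneg z hz)
      rw [Complex.exp_sub, Complex.exp_sub, Complex.exp_log h0, hexp, div_div, div_eq_one_iff_eq
        (mul_ne_zero (Complex.exp_ne_zero _) h0), mul_add, ← Complex.exp_add]
      simp [add_comm]
    have := eqOn_of_exp_eq (g := fun z => l z - u z - Complex.log (1 + Complex.exp (-u z))) (hline b)
      ((hl.sub hu).continuousOn.sub (ContinuousOn.clog (by fun_prop) hneg))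
      (fun x hx y hy => by simp only [hval x hx, hval y hy])
      (x := b + c) (y := b) (by simp [hcre]) (by simp)
    simp only [hper, neg_add, Complex.exp_add, Complex.exp_neg c, hexpc, mul_one, inv_one] at this
    linear_combination this
  have : c = 0 := by rw [← hB, ← hd, hA]
  exact Complex.two_pi_I_ne_zero this

theorem tendsto_isotopy_cobounded {H : ℝ → ℂ ≃ₜ ℂ} (hH : Continuous fun p : ℝ × ℂ => H p.1 p.2)
    (t₀ : ℝ) : Tendsto (fun p : ℝ × ℂ => H p.1 p.2) (𝓝 t₀ ×ˢ Bornology.cobounded ℂ)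
      (Bornology.cobounded ℂ) := by
  rw [← tendsto_norm_atTop_iff_cobounded, tendsto_atTop]
  intro M₀
  set M := max M₀ 1 with hM
  have hM1 : 1 ≤ M := le_max_right _ _
  have hcpt : IsCompact ((H t₀).symm '' Metric.closedBall 0 M) :=
    (isCompact_closedBall _ _).image (H t₀).symm.continuous
  obtain ⟨R, hR⟩ := hcpt.isBounded.subset_ball (0 : ℂ)
  set z₀ := (H t₀).symm 0
  have hz₀ : z₀ ∈ Metric.ball (0 : ℂ) R := hR ⟨0, by simp; linarith, rfl⟩
  have hsph : ∀ᶠ t in 𝓝 t₀, ∀ z ∈ Metric.sphere (0 : ℂ) R, M < ‖H t z‖ := by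
    refine (isCompact_sphere _ _).eventually_forall_of_forall_eventually fun z hz => ?_
    refine (hH.norm.tendsto (t₀, z)).eventually_const_lt ?_
    by_contra! hle
    have : z ∈ Metric.ball (0 : ℂ) R := hR ⟨H t₀ z, by simpa using hle, by simp⟩
    simp only [mem_sphere_iff_norm, sub_zero, Metric.mem_ball, dist_zero_right] at hz this
    linarith
  have hzero : ∀ᶠ t in 𝓝 t₀, ‖H t z₀‖ < M := by
    have : Continuous fun t => ‖H t z₀‖ :=
      (hH.comp (continuous_id.prodMk continuous_const)).norm
    exact (this.tendsto t₀).eventually_lt_const (by simp [z₀]; linarith)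
  have hbig : ∀ᶠ z in Bornology.cobounded ℂ, z ∉ Metric.closedBall (0 : ℂ) R :=
    Metric.isBounded_closedBall
  filter_upwards [(hsph.and hzero).prod_mk hbig] with ⟨t, z⟩ ⟨⟨h1, h2⟩, h3⟩
  by_contra! hlt
  have hsub : Metric.ball (0 : ℂ) M ⊆ H t '' Metric.ball 0 R := by
    refine (convex_ball (0 : ℂ) M).isPreconnected.subset_left_of_subset_union
      ((H t).isOpenMap _ Metric.isOpen_ball)
      ((H t).isOpenMap _ (Metric.isClosed_closedBall (x := (0 : ℂ)) (ε := R)).isOpen_compl)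
      ?_ ?_ ⟨H t z₀, by simpa using h2, z₀, hz₀, rfl⟩
    · exact (disjoint_compl_right.mono_left Metric.ball_subset_closedBall).image
        (H t).injective.injOn (subset_univ _) (subset_univ _)
    · intro w hw
      obtain ⟨x, rfl⟩ := (H t).surjective w
      rcases lt_trichotomy ‖x‖ R with hx | hx | hx
      · exact Or.inl ⟨x, by simpa using hx, rfl⟩
      · have := h1 x (by simpa using hx)
        simp at hw
        linarith
      · exact Or.inr ⟨x, by simpa using hx, rfl⟩
  obtain ⟨x, hx, hxz⟩ := hsub (show H t z ∈ Metric.ball (0 : ℂ) M from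
    mem_ball_zero_iff.2 (hlt.trans_le (le_max_left _ _)))
  rw [(H t).injective hxz] at hx
  exact h3 (Metric.ball_subset_closedBall hx)

/-- The ratio comparing, for an isotopy `H` from the identity, the Möbius coordinate
`(w - H t p) / (w - H t q)` of the image `w` of a point with the coordinate `v` of that point. -/
noncomputable def moebiusRatio (H : ℝ → ℂ ≃ₜ ℂ) (p q : ℂ) (x : ℝ × ℂ) : ℂ :=
  if x.2 = 1 then 1 else
    (H x.1 ((p - q * x.2) / (1 - x.2)) - H x.1 p) /
      (H x.1 ((p - q * x.2) / (1 - x.2)) - H x.1 q) / x.2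

theorem moebius_ne_left {p q v : ℂ} (hpq : p ≠ q) (hv0 : v ≠ 0) (hv1 : v ≠ 1) :
    (p - q * v) / (1 - v) ≠ p := by
  have : 1 - v ≠ 0 := sub_ne_zero.2 hv1.symm
  rw [Ne, div_eq_iff this]
  intro h
  exact mul_ne_zero hv0 (sub_ne_zero.2 hpq) (by linear_combination h)

theorem moebius_ne_right {p q v : ℂ} (hpq : p ≠ q) (hv1 : v ≠ 1) :
    (p - q * v) / (1 - v) ≠ q := by
  have : 1 - v ≠ 0 := sub_ne_zero.2 hv1.symm
  rw [Ne, div_eq_iff this]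
  intro h
  exact sub_ne_zero.2 hpq (by linear_combination h)

theorem moebiusRatio_ne_zero (H : ℝ → ℂ ≃ₜ ℂ) {p q : ℂ} (hpq : p ≠ q) {t : ℝ} {v : ℂ}
    (hv : v ≠ 0) : moebiusRatio H p q (t, v) ≠ 0 := by
  unfold moebiusRatio
  split_ifs with h
  · exact one_ne_zero
  · exact div_ne_zero (div_ne_zero
      (sub_ne_zero.2 ((H t).injective.ne (moebius_ne_left hpq hv h)))
      (sub_ne_zero.2 ((H t).injective.ne (moebius_ne_right hpq h)))) hv

theorem moebiusRatio_of_eq_refl {H : ℝ → ℂ ≃ₜ ℂ} (h0 : H 0 = Homeomorph.refl ℂ) {p q v : ℂ}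
    (hpq : p ≠ q) (hv : v ≠ 0) : moebiusRatio H p q (0, v) = 1 := by
  unfold moebiusRatio
  split_ifs with h
  · rfl
  · have h1 : 1 - v ≠ 0 := sub_ne_zero.2 (Ne.symm h)
    have h2 := sub_ne_zero.2 (moebius_ne_right hpq h)
    simp only [h0, Homeomorph.refl_apply, id_eq]
    simp only at h h2
    rw [div_div, div_eq_one_iff_eq (mul_ne_zero h2 hv)]
    field_simp
    ring

theorem continuousAt_moebiusRatio {H : ℝ → ℂ ≃ₜ ℂ}
    (hH : Continuous fun p : ℝ × ℂ => H p.1 p.2) {p q : ℂ} (hpq : p ≠ q) {t : ℝ} {v : ℂ}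
    (hv : v ≠ 0) : ContinuousAt (moebiusRatio H p q) (t, v) := by
  have hHc : ∀ c, Continuous fun x : ℝ × ℂ => H x.1 c := fun c =>
    hH.comp (continuous_fst.prodMk continuous_const)
  by_cases h : v = 1
  · subst h
    have hmob : Tendsto (fun x : ℝ × ℂ => (p - q * x.2) / (1 - x.2))
        (𝓝[{x | x.2 ≠ 1}] (t, 1)) (Bornology.cobounded ℂ) := by
      rw [← tendsto_norm_atTop_iff_cobounded]
      have hnum : Tendsto (fun x : ℝ × ℂ => ‖p - q * x.2‖) (𝓝[{x | x.2 ≠ 1}] (t, 1))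
          (𝓝 ‖p - q‖) := by
        have : Continuous fun x : ℝ × ℂ => ‖p - q * x.2‖ := by fun_prop
        simpa using (this.tendsto (t, (1 : ℂ))).mono_left nhdsWithin_le_nhds
      have hden : Tendsto (fun x : ℝ × ℂ => ‖1 - x.2‖) (𝓝[{x | x.2 ≠ 1}] (t, 1)) (𝓝[>] 0) := by
        refine tendsto_nhdsWithin_iff.2 ⟨?_, ?_⟩
        · have : Continuous fun x : ℝ × ℂ => ‖1 - x.2‖ := by fun_prop
          simpa using (this.tendsto (t, (1 : ℂ))).mono_left nhdsWithin_le_nhds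
        · filter_upwards [self_mem_nhdsWithin] with x hx
          exact norm_pos_iff.2 (sub_ne_zero.2 (Ne.symm hx))
      have := Tendsto.pos_mul_atTop (norm_pos_iff.2 (sub_ne_zero.2 hpq)) hnum
        hden.inv_tendsto_nhdsGT_zero
      simpa [div_eq_mul_inv] using this
    have hfst : Tendsto (fun x : ℝ × ℂ => x.1) (𝓝[{x | x.2 ≠ 1}] (t, 1)) (𝓝 t) :=
      (continuous_fst.tendsto (t, (1 : ℂ))).mono_left nhdsWithin_le_nhds
    have hbig : Tendsto (fun x : ℝ × ℂ => H x.1 ((p - q * x.2) / (1 - x.2)) - H x.1 q)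
        (𝓝[{x | x.2 ≠ 1}] (t, 1)) (Bornology.cobounded ℂ) := by
      have h1 := (tendsto_isotopy_cobounded hH t).comp (hfst.prodMk hmob)
      rw [← tendsto_norm_atTop_iff_cobounded] at h1 ⊢
      have h2 : Tendsto (fun x : ℝ × ℂ => ‖H x.1 q‖) (𝓝[{x | x.2 ≠ 1}] (t, 1)) (𝓝 ‖H t q‖) :=
        ((hHc q).norm.tendsto (t, (1 : ℂ))).mono_left nhdsWithin_le_nhds
      refine tendsto_atTop_mono (fun x => ?_) (h1.atTop_add h2.neg)
      simpa [sub_eq_add_neg] using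
        norm_sub_norm_le (H x.1 ((p - q * x.2) / (1 - x.2))) (H x.1 q)
    have hlim : Tendsto (fun x : ℝ × ℂ => (1 + (H x.1 q - H x.1 p) *
        (H x.1 ((p - q * x.2) / (1 - x.2)) - H x.1 q)⁻¹) / x.2)
        (𝓝[{x | x.2 ≠ 1}] (t, 1)) (𝓝 1) := by
      have h1 : Tendsto (fun x : ℝ × ℂ => H x.1 q - H x.1 p) (𝓝[{x | x.2 ≠ 1}] (t, 1))
          (𝓝 (H t q - H t p)) :=
        (((hHc q).sub (hHc p)).tendsto (t, (1 : ℂ))).mono_left nhdsWithin_le_nhds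
      have h2 : Tendsto (fun x : ℝ × ℂ => x.2) (𝓝[{x | x.2 ≠ 1}] (t, 1)) (𝓝 1) :=
        (continuous_snd.tendsto (t, (1 : ℂ))).mono_left nhdsWithin_le_nhds
      have h3 := (tendsto_const_nhds (x := (1 : ℂ))).add
        (h1.mul (tendsto_inv₀_cobounded.comp hbig))
      simpa [Pi.div_def] using h3.div h2 one_ne_zero
    have hone : moebiusRatio H p q (t, 1) = 1 := by simp [moebiusRatio]
    rw [ContinuousAt, hone, ← nhdsWithin_univ,
      show (univ : Set (ℝ × ℂ)) = {x | x.2 ≠ 1} ∪ {x | x.2 = 1} by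
        ext x; simp [em'], nhdsWithin_union]
    refine Tendsto.sup (hlim.congr' ?_) (tendsto_const_nhds.congr' ?_)
    · filter_upwards [self_mem_nhdsWithin] with x hx
      have hx' : x.2 ≠ 1 := hx
      have := sub_ne_zero.2 ((H x.1).injective.ne (moebius_ne_right hpq hx'))
      rw [moebiusRatio, if_neg hx']
      congr 1
      rw [eq_div_iff this, add_mul, mul_assoc, inv_mul_cancel₀ this]
      ring
    · filter_upwards [self_mem_nhdsWithin] with x hx
      have hx' : x.2 = 1 := hx
      rw [moebiusRatio, if_pos hx']
  · have hev : ∀ᶠ x : ℝ × ℂ in 𝓝 (t, v), x.2 ≠ 1 :=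
      (continuous_snd.tendsto (t, v)).eventually_ne h
    have h1 : (1 : ℂ) - v ≠ 0 := sub_ne_zero.2 (Ne.symm h)
    have hm : ContinuousAt (fun x : ℝ × ℂ => (x.1, (p - q * x.2) / (1 - x.2))) (t, v) :=
      continuousAt_fst.prodMk (ContinuousAt.div (by fun_prop) (by fun_prop) h1)
    have hHm : ContinuousAt (fun x : ℝ × ℂ => H x.1 ((p - q * x.2) / (1 - x.2))) (t, v) :=
      ContinuousAt.comp (g := fun x : ℝ × ℂ => H x.1 x.2) hH.continuousAt hm
    refine ContinuousAt.congr (((hHm.sub (hHc p).continuousAt).div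
      (hHm.sub (hHc q).continuousAt)
      (sub_ne_zero.2 ((H t).injective.ne (moebius_ne_right hpq h)))).div continuousAt_snd hv) ?_
    filter_upwards [hev] with x hx
    rw [moebiusRatio, if_neg hx]
    rfl

theorem sq_mul_div_div {v : ℂ} (hv : v ≠ 0) (a b : ℂ) : v ^ 2 * (a / b / v) = v * (a / b) := by
  field_simp

/-- A homeomorphism of the plane isotopic to the identity. -/
def IsIsotopic (f : ℂ ≃ₜ ℂ) : Prop :=
  ∃ H : ℝ → ℂ ≃ₜ ℂ, Continuous (fun p : ℝ × ℂ => H p.1 p.2) ∧ H 0 = Homeomorph.refl ℂ ∧ H 1 = f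

/-- A homeomorphism isotopic to the identity that exchanges two points has a fixed point. -/
theorem exists_fixed_of_swap {f : ℂ ≃ₜ ℂ} (hf : IsIsotopic f) {p q : ℂ} (hpq : p ≠ q)
    (hp : f p = q) (hq : f q = p) : ∃ z, f z = z := by
  obtain ⟨H, hH, h0, rfl⟩ := hf
  have hexpcont : Continuous fun x : I × ℂ => ((x.1 : ℝ), Complex.exp x.2) := by fun_prop
  obtain ⟨L, hL, hLexp, hL0⟩ := exists_log_homotopy (A := ℂ)
    (F := fun x => moebiusRatio H p q ((x.1 : ℝ), Complex.exp x.2))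
    (continuous_iff_continuousAt.2 fun x =>
      ContinuousAt.comp (g := moebiusRatio H p q)
        (continuousAt_moebiusRatio hH hpq (Complex.exp_ne_zero x.2)) hexpcont.continuousAt)
    (fun x => moebiusRatio_ne_zero H hpq (Complex.exp_ne_zero _)) (l := fun _ => 0)
    continuous_const
    (fun a => by simp [moebiusRatio_of_eq_refl h0 hpq (Complex.exp_ne_zero a)])
  have hLper : ∀ z, L (1, z + 2 * Real.pi * Complex.I) = L (1, z) := fun z => by
    have := eqOn_of_exp_eq (A := I)
      (g := fun t => L (t, z + 2 * Real.pi * Complex.I) - L (t, z)) isPreconnected_univ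
      (by fun_prop) (fun x _ y _ => by
        simp [Complex.exp_sub, hLexp, Complex.exp_add,
          moebiusRatio_ne_zero H hpq (Complex.exp_ne_zero z)])
      (mem_univ 1) (mem_univ 0)
    simpa [hL0, sub_eq_zero] using this
  have hLone : ∀ z, Complex.exp z = 1 → L (1, z) = 0 := fun z hz => by
    have := eqOn_of_exp_eq (A := I) (g := fun t => L (t, z)) isPreconnected_univ
      (by fun_prop) (fun x _ y _ => by simp [hLexp, hz, moebiusRatio])
      (mem_univ 1) (mem_univ 0)
    simpa [hL0] using this
  set u : ℂ → ℂ := fun z => z + L (1, z) / 2 with hu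
  have hsq : ∀ z, Complex.exp (u z) ^ 2 =
      Complex.exp z ^ 2 * moebiusRatio H p q (1, Complex.exp z) := fun z => by
    have := hLexp (1, z)
    simp only [Icc.coe_one] at this
    rw [← this, ← Complex.exp_nat_mul, ← Complex.exp_nat_mul, ← Complex.exp_add, hu]
    congr 1
    push_cast
    ring
  have hnorm : ∀ z, ‖Complex.exp z‖ = Real.exp z.re := Complex.norm_exp
  obtain ⟨a, ha⟩ : ∃ a : ℝ, ∀ z : ℂ, z.re = a → (u z).re < 0 := by
    have hc : ContinuousAt (fun v : ℂ => v * ((H 1 ((p - q * v) / (1 - v)) - H 1 p) /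
        (H 1 ((p - q * v) / (1 - v)) - H 1 q))) 0 := by
      have hm : ContinuousAt (fun v : ℂ => (p - q * v) / (1 - v)) 0 :=
        ContinuousAt.div (by fun_prop) (by fun_prop) (by simp)
      have := (H 1).continuous.continuousAt.comp hm
      refine continuousAt_id.mul ((this.sub continuousAt_const).div
        (this.sub continuousAt_const) ?_)
      simpa [sub_eq_zero] using hpq
    have hev := hc.norm.eventually_lt_const (u := 1) (by simp)
    obtain ⟨ε, hε, hball⟩ := Metric.eventually_nhds_iff.1 hev
    refine ⟨Real.log (min (ε / 2) (1 / 2)), fun z hz => ?_⟩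
    have hz' : ‖Complex.exp z‖ = min (ε / 2) (1 / 2) := by
      rw [hnorm, hz, Real.exp_log (by positivity)]
    have h1 : Complex.exp z ≠ 1 := fun h => by
      rw [h, norm_one] at hz'
      linarith [min_le_right (ε / 2) (1 / 2 : ℝ)]
    have h2 := hball (y := Complex.exp z) (by
      rw [dist_zero_right, hz']
      linarith [min_le_left (ε / 2) (1 / 2 : ℝ)])
    have h3 : ‖Complex.exp (u z) ^ 2‖ < 1 := by
      rw [hsq, moebiusRatio, if_neg h1, sq_mul_div_div (Complex.exp_ne_zero z)]
      exact h2
    rw [norm_pow, hnorm] at h3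
    have := (pow_lt_one_iff_of_nonneg (Real.exp_pos _).le two_ne_zero).1 h3
    rwa [Real.exp_lt_one_iff] at this
  obtain ⟨b, hb⟩ : ∃ b : ℝ, ∀ z : ℂ, z.re = b → 0 < (u z).re := by
    have hc : ContinuousAt (fun w : ℂ => w * ((H 1 ((p * w - q) / (w - 1)) - H 1 q) /
        (H 1 ((p * w - q) / (w - 1)) - H 1 p))) 0 := by
      have hm : ContinuousAt (fun w : ℂ => (p * w - q) / (w - 1)) 0 :=
        ContinuousAt.div (by fun_prop) (by fun_prop) (by simp)
      have := (H 1).continuous.continuousAt.comp hm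
      refine continuousAt_id.mul ((this.sub continuousAt_const).div
        (this.sub continuousAt_const) ?_)
      simpa [sub_eq_zero] using hpq.symm
    have hev := hc.norm.eventually_lt_const (u := 1) (by simp)
    obtain ⟨ε, hε, hball⟩ := Metric.eventually_nhds_iff.1 hev
    refine ⟨-Real.log (min (ε / 2) (1 / 2)), fun z hz => ?_⟩
    have hz' : ‖(Complex.exp z)⁻¹‖ = min (ε / 2) (1 / 2) := by
      rw [norm_inv, hnorm, hz, Real.exp_neg, inv_inv, Real.exp_log (by positivity)]
    have h1 : Complex.exp z ≠ 1 := fun h => by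
      rw [h, inv_one, norm_one] at hz'
      linarith [min_le_right (ε / 2) (1 / 2 : ℝ)]
    have h2 := hball (y := (Complex.exp z)⁻¹) (by
      rw [dist_zero_right, hz']
      linarith [min_le_left (ε / 2) (1 / 2 : ℝ)])
    have h0 := Complex.exp_ne_zero z
    have hmob : (p * (Complex.exp z)⁻¹ - q) / ((Complex.exp z)⁻¹ - 1) =
        (p - q * Complex.exp z) / (1 - Complex.exp z) := by
      rw [← mul_div_mul_right _ _ h0, sub_mul, sub_mul, mul_assoc, inv_mul_cancel₀ h0, one_mul,
        mul_one]
    have h3 : ‖(Complex.exp (u z) ^ 2)⁻¹‖ < 1 := by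
      rw [hsq, moebiusRatio, if_neg h1, sq_mul_div_div h0, mul_inv, inv_div]
      rw [hmob] at h2
      exact h2
    rw [← Complex.exp_nat_mul, ← Complex.exp_neg, hnorm, Real.exp_lt_one_iff] at h3
    simp at h3
    exact h3
  obtain ⟨z, hz⟩ := exists_exp_eq_neg_one (u := u) (by fun_prop)
    (fun z => by simp only [hu, hLper]; ring) ha hb
  have hz1 : Complex.exp z ≠ 1 := fun h => by
    rw [hu] at hz
    simp only [hLone z h, zero_div, add_zero, h] at hz
    norm_num at hz
  have h := hsq z
  set v := Complex.exp z with hv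
  have hv0 : v ≠ 0 := Complex.exp_ne_zero z
  rw [hz, moebiusRatio, if_neg hz1] at h
  have hr := sub_ne_zero.2 ((H 1).injective.ne (moebius_ne_right hpq hz1))
  have h1v : 1 - v ≠ 0 := sub_ne_zero.2 hz1.symm
  refine ⟨(p - q * v) / (1 - v), ?_⟩
  simp only [hp, hq] at h hr
  set w := H 1 ((p - q * v) / (1 - v))
  rw [eq_div_iff h1v]
  field_simp at h
  linear_combination h

theorem IsIsotopic.trans {f g : ℂ ≃ₜ ℂ} (hg : IsIsotopic g) (hf : IsIsotopic f) :
    IsIsotopic (g.trans f) := by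
  obtain ⟨G, hG, hG0, rfl⟩ := hg
  obtain ⟨H, hH, hH0, rfl⟩ := hf
  refine ⟨fun t => (G t).trans (H t), hH.comp (continuous_fst.prodMk hG), ?_, rfl⟩
  ext z
  simp [hG0, hH0]

theorem exists_homeomorph_add {ψ : ℂ → ℂ} {K : NNReal} (hψ : LipschitzWith K ψ) (hK : K < 1) :
    ∃ e : ℂ ≃ₜ ℂ, ∀ z, e z = z + ψ z := by
  have happrox : ApproximatesLinearOn (fun z => z + ψ z)
      ((ContinuousLinearEquiv.refl ℝ ℂ : ℂ ≃L[ℝ] ℂ) : ℂ →L[ℝ] ℂ) univ K := fun x _ y _ => by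
    change ‖x + ψ x - (y + ψ y) - (x - y)‖ ≤ K * ‖x - y‖
    rw [show x + ψ x - (y + ψ y) - (x - y) = ψ x - ψ y by ring, ← dist_eq_norm, ← dist_eq_norm]
    exact hψ.dist_le_mul x y
  refine ⟨happrox.toHomeomorph _ (Or.inr ?_), fun z => rfl⟩
  have : ‖(((ContinuousLinearEquiv.refl ℝ ℂ).symm : ℂ ≃L[ℝ] ℂ) : ℂ →L[ℝ] ℂ)‖₊ = 1 :=
    NNReal.eq (ContinuousLinearMap.norm_id)
  rw [this, inv_one]
  exact hK

theorem exists_isotopic_map_ball {a b : ℂ} {r : ℝ} (hb : dist b a < r / 2) :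
    ∃ g : ℂ ≃ₜ ℂ, IsIsotopic g ∧ g a = b ∧ ∀ z ∉ Metric.ball a r, g z = z := by
  have hr : 0 < r := by linarith [dist_nonneg (x := b) (y := a)]
  set φ : ℂ → ℝ := fun z => max 0 (1 - dist z a / r) with hφ
  set τ : ℝ → ℝ := fun t => (projIcc 0 1 zero_le_one t : ℝ) with hτ
  have hτ1 : ∀ t, |τ t| ≤ 1 := fun t => by
    rw [abs_of_nonneg (projIcc 0 1 zero_le_one t).2.1]
    exact (projIcc 0 1 zero_le_one t).2.2
  have hφlip : ∀ z w, |φ z - φ w| ≤ dist z w / r := fun z w => by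
    rw [hφ]
    refine (abs_max_sub_max_le_max _ _ _ _).trans ?_
    rw [sub_self, abs_zero, max_eq_right (abs_nonneg _),
      show 1 - dist z a / r - (1 - dist w a / r) = (dist w a - dist z a) / r by ring, abs_div,
      abs_of_pos hr]
    gcongr
    rw [abs_sub_comm]
    exact abs_dist_sub_le z w a
  have hlip : ∀ t, LipschitzWith (1 / 2) fun z => ((τ t * φ z : ℝ) : ℂ) * (b - a) := fun t =>
    LipschitzWith.of_dist_le_mul fun z w => by
      rw [dist_eq_norm, ← sub_mul, ← Complex.ofReal_sub, ← mul_sub, norm_mul, Complex.norm_real,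
        norm_mul, Real.norm_eq_abs, Real.norm_eq_abs, ← dist_eq_norm]
      push_cast
      calc |τ t| * |φ z - φ w| * dist b a ≤ 1 * (dist z w / r) * (r / 2) := by
            gcongr
            · exact hτ1 t
            · exact hφlip z w
        _ = 1 / 2 * dist z w := by field_simp
  choose G hG using fun t => exists_homeomorph_add (hlip t) (by norm_num)
  have hτc : Continuous τ := continuous_subtype_val.comp continuous_projIcc
  have hφc : Continuous φ := by fun_prop
  refine ⟨G 1, ⟨G, ?_, ?_, rfl⟩, ?_, fun z hz => ?_⟩
  · simp only [hG]
    fun_prop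
  · ext z
    simp [hG, hτ]
  · simp [hG, hτ, hφ]
  · have : φ z = 0 := by
      rw [hφ]
      refine max_eq_left ?_
      rw [sub_nonpos, one_le_div hr]
      simpa using hz
    simp [hG, this]

theorem exists_isotopic_map {U : Set ℂ} (hU : IsOpen U) (hc : IsPreconnected U) {a b : ℂ}
    (ha : a ∈ U) (hb : b ∈ U) :
    ∃ g : ℂ ≃ₜ ℂ, IsIsotopic g ∧ g a = b ∧ ∀ z ∉ U, g z = z := by
  refine hc.induction₂' (fun a b => ∃ g : ℂ ≃ₜ ℂ, IsIsotopic g ∧ g a = b ∧ ∀ z ∉ U, g z = z)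
    (fun x hx => ?_) ?_ ha hb
  · obtain ⟨r, hr, hball⟩ := Metric.isOpen_iff.1 hU x hx
    refine mem_nhdsWithin_of_mem_nhds ?_
    filter_upwards [Metric.ball_mem_nhds x (show 0 < r / 4 by linarith)] with y hy
    rw [Metric.mem_ball] at hy
    obtain ⟨g, hg, hgx, hgo⟩ := exists_isotopic_map_ball (a := x) (b := y) (r := r) (by linarith)
    obtain ⟨g', hg', hgx', hgo'⟩ := exists_isotopic_map_ball (a := y) (b := x) (r := r / 2)
      (by rw [dist_comm]; linarith)
    refine ⟨⟨g, hg, hgx, fun z hz => hgo z fun h => hz (hball h)⟩,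
      ⟨g', hg', hgx', fun z hz => hgo' z fun h => hz (hball ?_)⟩⟩
    rw [Metric.mem_ball] at h ⊢
    linarith [dist_triangle z y x]
  · rintro x y z - - - ⟨g, hg, rfl, hgo⟩ ⟨g', hg', rfl, hgo'⟩
    exact ⟨g.trans g', hg.trans hg', rfl, fun w hw => by simp [hgo w hw, hgo' w hw]⟩

/-- A fixed point free homeomorphism of the plane isotopic to the identity. -/
def IsBrouwer (f : ℂ ≃ₜ ℂ) : Prop := IsIsotopic f ∧ ∀ x, f x ≠ x

/-- Free modification: a Brouwer homeomorphism can be modified inside a free domain. -/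
theorem IsBrouwer.exists_perturb {f : ℂ ≃ₜ ℂ} (hf : IsBrouwer f) {U : Set ℂ} (hU : IsOpen U)
    (hc : IsPreconnected U) (hfree : ∀ x ∈ U, f x ∉ U) {a b : ℂ} (ha : a ∈ U) (hb : b ∈ U) :
    ∃ g : ℂ ≃ₜ ℂ, IsBrouwer (g.trans f) ∧ g a = b ∧ ∀ x ∉ U, g x = x := by
  obtain ⟨g, hg, hgab, hgo⟩ := exists_isotopic_map hU hc ha hb
  refine ⟨g, ⟨hg.trans hf.1, fun x hx => ?_⟩, hgab, hgo⟩
  rw [Homeomorph.trans_apply] at hx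
  by_cases hxU : x ∈ U
  · have : g x ∈ U := by
      by_contra h
      exact h ((g.injective (hgo _ h)).symm ▸ hxU)
    exact hfree _ this (hx.symm ▸ hxU)
  · rw [hgo x hxU] at hx
    exact hf.2 x hx

theorem iterate_comp_eq_iterate {X : Type*} {f g : X → X} {a y : X} (hg : g y = a) {n : ℕ}
    (h : ∀ k, 0 < k → k < n → g (f^[k] a) = f^[k] a) {k : ℕ} (hk : 0 < k) (hkn : k ≤ n) :
    (f ∘ g)^[k] y = f^[k] a := by
  induction k, hk using Nat.le_induction with
  | base => simp [hg]
  | succ k hk ih =>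
    rw [Function.iterate_succ_apply', ih (by omega), Function.iterate_succ_apply',
      Function.comp_apply, h k hk (by omega)]

theorem IsBrouwer.iterate_notMem {f : ℂ ≃ₜ ℂ} (hf : IsBrouwer f) {U : Set ℂ} (hU : IsOpen U)
    (hc : IsPreconnected U) (hfree : ∀ x ∈ U, f x ∉ U) {x : ℂ} (hx : x ∈ U) {n : ℕ} (hn : 0 < n)
    (hper : ∀ k, 0 < k → k ≤ n → ∀ F : ℂ ≃ₜ ℂ, IsBrouwer F → ∀ y, F^[k] y ≠ y) :
    f^[n] x ∉ U := by
  induction n using Nat.strong_induction_on with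
  | _ n ih =>
    intro hmem
    obtain ⟨g, hg, hgx, hgo⟩ := hf.exists_perturb hU hc hfree hmem hx
    exact hper n hn le_rfl _ hg _ (iterate_comp_eq_iterate (f := f) hgx
      (fun k hk hkn => hgo _ (ih k hkn hk fun j hj hjk => hper j hj (hjk.trans hkn.le))) hn le_rfl)

/-- A cycle of two disjoint free domains can be closed up to a periodic orbit. -/
theorem IsBrouwer.exists_periodic_of_cycle {f : ℂ ≃ₜ ℂ} (hf : IsBrouwer f) {U V : Set ℂ}
    (hU : IsOpen U) (hUc : IsPreconnected U) (hUfree : ∀ x ∈ U, f x ∉ U)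
    (hV : IsOpen V) (hVc : IsPreconnected V) (hVfree : ∀ x ∈ V, f x ∉ V) (hUV : Disjoint U V)
    {a b : ℂ} {i j : ℕ} (ha : a ∈ U) (hb : b ∈ V) (hi : 0 < i) (hj : 0 < j)
    (hai : f^[i] a ∈ V) (hbj : f^[j] b ∈ U)
    (hai' : ∀ k, 0 < k → k < i → f^[k] a ∉ U ∧ f^[k] a ∉ V)
    (hbj' : ∀ k, 0 < k → k < j → f^[k] b ∉ U ∧ f^[k] b ∉ V) :
    ∃ F : ℂ ≃ₜ ℂ, IsBrouwer F ∧ ∃ x, F^[i + j] x = x := by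
  obtain ⟨g, hg, hgx, hgo⟩ := hf.exists_perturb hU hUc hUfree hbj ha
  obtain ⟨g', hg', hgx', hgo'⟩ := hg.exists_perturb hV hVc (fun x hx => by
    rw [Homeomorph.trans_apply, hgo x (hUV.notMem_of_mem_right hx)]
    exact hVfree x hx) hai hb
  refine ⟨_, hg', f^[j] b, ?_⟩
  have hfun : (⇑(g'.trans (g.trans f)) : ℂ → ℂ) = f ∘ (g ∘ g') := rfl
  rw [hfun, add_comm, Function.iterate_add_apply,
    iterate_comp_eq_iterate (f := f) (a := a) (n := i) _ _ hi le_rfl,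
    iterate_comp_eq_iterate (f := f) (a := b) (n := j) _ _ hj le_rfl]
  · rw [Function.comp_apply, hgx', hgo b (hUV.notMem_of_mem_right hb)]
  · intro k hk hkj
    rw [Function.comp_apply, hgo' _ (hbj' k hk hkj).2, hgo _ (hbj' k hk hkj).1]
  · rw [Function.comp_apply, hgo' _ (hUV.notMem_of_mem_left hbj), hgx]
  · intro k hk hkj
    rw [Function.comp_apply, hgo' _ (hai' k hk hkj).2, hgo _ (hai' k hk hkj).1]

theorem isCompact_segment (x y : ℂ) : IsCompact (segment ℝ x y) := by
  rw [segment_eq_image_lineMap]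
  exact isCompact_Icc.image AffineMap.lineMap_continuous

theorem exists_convex_open_between {x y : ℂ} {O : Set ℂ} (hO : IsOpen O)
    (h : segment ℝ x y ⊆ O) : ∃ W, IsOpen W ∧ Convex ℝ W ∧ segment ℝ x y ⊆ W ∧ W ⊆ O := by
  obtain ⟨δ, hδ, hsub⟩ := (isCompact_segment x y).exists_thickening_subset_open hO h
  exact ⟨_, Metric.isOpen_thickening, (convex_segment x y).thickening δ,
    Metric.self_subset_thickening hδ _, hsub⟩

theorem eq_or_mem_ball_of_mem_segment {x y w : ℂ} (hw : w ∈ segment ℝ x y) :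
    w = y ∨ w ∈ Metric.ball x (dist y x) := by
  rw [segment_eq_image_lineMap] at hw
  obtain ⟨θ, ⟨h0, h1⟩, rfl⟩ := hw
  rcases h1.eq_or_lt with rfl | h1
  · simp
  · rcases eq_or_ne y x with rfl | hne
    · simp
    · right
      rw [Metric.mem_ball, dist_lineMap_left, Real.norm_of_nonneg h0, dist_comm x y]
      exact mul_lt_of_lt_one_left (dist_pos.2 hne) h1

/-- Every point `x` is the centre of a free disk whose boundary contains a point and its image. -/
theorem IsBrouwer.exists_critical_ball {f : ℂ ≃ₜ ℂ} (hf : IsBrouwer f) (x : ℂ) :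
    ∃ r y, 0 < r ∧ dist y x = r ∧ dist (f y) x = r ∧
      (∀ z, dist z x < r → r < dist (f z) x) ∧ ∀ z, dist z x ≤ r → r ≤ dist (f z) x := by
  have hcont : Continuous fun z => max (dist z x) (dist (f z) x) := by fun_prop
  obtain ⟨y, hy⟩ := hcont.exists_forall_le (tendsto_atTop_mono (fun z => le_max_left _ _)
    (tendsto_dist_right_cocompact_atTop x))
  set r := max (dist y x) (dist (f y) x) with hr
  have hfree : ∀ z, dist z x < r → r ≤ dist (f z) x := fun z hz =>
    (le_max_iff.1 (hy z)).resolve_left hz.not_ge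
  have hr0 : 0 < r := by
    by_contra! h
    have h1 : dist y x ≤ 0 := (le_max_left _ _).trans h
    have h2 : dist (f y) x ≤ 0 := (le_max_right _ _).trans h
    rw [dist_le_zero] at h1 h2
    exact hf.2 y (h2.trans h1.symm)
  have hmeet : ∀ {S : Set ℂ} {z : ℂ}, IsOpen S → z ∈ S → dist z x ≤ r →
      ∃ w ∈ S, dist w x < r := fun {S z} hS hzS hz => by
    have : z ∈ closure (Metric.ball x r) := by
      rwa [closure_ball x hr0.ne', Metric.mem_closedBall]
    obtain ⟨w, hw, hwr⟩ := mem_closure_iff.1 this S hS hzS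
    exact ⟨w, hw, hwr⟩
  have hle : ∀ z, dist z x ≤ r → r ≤ dist (f z) x := fun z hz => by
    by_contra! h
    obtain ⟨w, hw, hwr⟩ := hmeet (Metric.isOpen_ball.preimage f.continuous)
      (show z ∈ f ⁻¹' Metric.ball x r from h) hz
    exact (hfree w hwr).not_gt hw
  have hlt : ∀ z, dist z x < r → r < dist (f z) x := fun z hz => by
    by_contra! h
    obtain ⟨_, ⟨w, hw, rfl⟩, hwr⟩ := hmeet (f.isOpenMap _ Metric.isOpen_ball)
      (show f z ∈ f '' Metric.ball x r from ⟨z, hz, rfl⟩) h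
    exact (hfree w hw).not_gt hwr
  have hyr : dist y x ≤ r := le_max_left _ _
  have hfyr : dist (f y) x ≤ r := le_max_right _ _
  refine ⟨r, y, hr0, hyr.antisymm ?_, hfyr.antisymm (hle y hyr), hlt, hle⟩
  by_contra! h
  exact (hlt y h).not_ge hfyr

theorem exists_free_convex {f : ℂ ≃ₜ ℂ} {x y : ℂ} (hfree : ∀ z ∈ segment ℝ x y, f z ∉ segment ℝ x y)
    {O : Set ℂ} (hO : IsOpen O) (h : segment ℝ x y ⊆ O) :
    ∃ W, IsOpen W ∧ IsPreconnected W ∧ (∀ z ∈ W, f z ∉ W) ∧ segment ℝ x y ⊆ W ∧ W ⊆ O := by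
  obtain ⟨A, B, hA, hB, hKA, hKB, hAB⟩ := SeparatedNhds.of_isCompact_isCompact
    (isCompact_segment x y) ((isCompact_segment x y).image f.continuous)
    (disjoint_right.2 (by rintro _ ⟨z, hz, rfl⟩; exact hfree z hz))
  obtain ⟨W, hW, hWc, hKW, hWO⟩ := exists_convex_open_between
    ((hA.inter (hB.preimage f.continuous)).inter hO)
    (subset_inter (subset_inter hKA (image_subset_iff.1 hKB)) h)
  exact ⟨W, hW, hWc.isPreconnected, fun z hz hfz =>
    hAB.notMem_of_mem_left (hWO hfz).1.1 (hWO hz).1.2, hKW, hWO.trans inter_subset_right⟩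

/-- Brouwer's theorem: a fixed point free homeomorphism of the plane isotopic to the identity
has no periodic point. -/
theorem IsBrouwer.iterate_ne {n : ℕ} (hn : 0 < n) {f : ℂ ≃ₜ ℂ} (hf : IsBrouwer f) (x : ℂ) :
    f^[n] x ≠ x := by
  induction n using Nat.strong_induction_on generalizing f x with
  | _ n ih =>
  match n, hn with
  | 1, _ => exact hf.2 x
  | 2, _ =>
    intro h
    obtain ⟨z, hz⟩ := exists_fixed_of_swap hf.1 (hf.2 x).symm rfl h
    exact hf.2 z hz
  | m + 3, _ =>
    intro hper
    have hrec : ∀ U : Set ℂ, IsOpen U → IsPreconnected U → (∀ z ∈ U, f z ∉ U) → ∀ z ∈ U, ∀ k,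
        0 < k → k < m + 3 → f^[k] z ∉ U := fun U hU hc hfree z hz k hk hkm =>
      hf.iterate_notMem hU hc hfree hz hk fun j hj hjk F hF y => ih j (by omega) hj hF y
    obtain ⟨r, y, hr, hy, hfy, hlt, hle⟩ := hf.exists_critical_ball x
    have hball : ∀ z, dist z x < r → ¬ dist (f (f z)) x < r := fun z hz =>
      hrec (Metric.ball x r) Metric.isOpen_ball (convex_ball x r).isPreconnected
        (fun z hz hfz => (hlt z hz).not_gt hfz) z hz 2 (by omega) (by omega)
    have hK₁ : ∀ z ∈ segment ℝ x y, z = y ∨ dist z x < r := fun z hz => by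
      simpa [hy] using eq_or_mem_ball_of_mem_segment hz
    have hK₂ : ∀ z ∈ segment ℝ x (f y), z = f y ∨ dist z x < r := fun z hz => by
      simpa [hfy] using eq_or_mem_ball_of_mem_segment hz
    have hffy : f (f y) ∉ segment ℝ x (f y) := fun h => by
      rcases hK₂ _ h with h | h
      · exact hf.2 _ h
      · exact (hle _ hfy.le).not_gt h
    have hfree₁ : ∀ z ∈ segment ℝ x y, f z ∉ segment ℝ x y := fun z hz hfz => by
      rcases hK₁ z hz with rfl | h <;> rcases hK₁ _ hfz with h' | h'
      · exact hf.2 _ h'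
      · exact h'.ne hfy
      · exact (hlt z h).ne' (h' ▸ hy)
      · exact (hlt z h).not_gt h'
    have hfree₂ : ∀ z ∈ segment ℝ x (f y), f z ∉ segment ℝ x (f y) := fun z hz hfz => by
      rcases hK₂ z hz with rfl | h
      · exact hffy hfz
      · rcases hK₂ _ hfz with h' | h'
        · exact (hlt z h).ne' (h' ▸ hfy)
        · exact (hlt z h).not_gt h'
    have hdisj : ∀ z ∈ segment ℝ x y, f (f z) ∉ segment ℝ x (f y) := fun z hz hfz => by
      rcases hK₁ z hz with rfl | h
      · exact hffy hfz
      · rcases hK₂ _ hfz with h' | h'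
        · exact (hlt z h).ne' (f.injective h' ▸ hy)
        · exact hball z h h'
    obtain ⟨A, B, hA, hB, hKA, hKB, hAB⟩ := SeparatedNhds.of_isCompact_isCompact
      (isCompact_segment x (f y))
      ((isCompact_segment x y).image (f.continuous.comp f.continuous))
      (disjoint_right.2 (by rintro _ ⟨z, hz, rfl⟩; exact hdisj z hz))
    obtain ⟨T, hT, hTc, hTfree, hKT, hTB⟩ := exists_free_convex hfree₁
      (hB.preimage (f.continuous.comp f.continuous)) (image_subset_iff.1 hKB)
    obtain ⟨W, hW, hWc, hWfree, hKW, hWA⟩ := exists_free_convex hfree₂ hA hKA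
    have hxT : x ∈ T := hKT (left_mem_segment ℝ x y)
    have hxW : x ∈ W := hKW (left_mem_segment ℝ x (f y))
    have hiter : ∀ k, f^[k] (f (f x)) = f (f (f^[k] x)) := fun k => by
      induction k with
      | zero => rfl
      | succ k ih => rw [Function.iterate_succ_apply', ih, Function.iterate_succ_apply']
    obtain ⟨F, hF, z, hz⟩ := hf.exists_periodic_of_cycle (U := W) (V := f '' (f '' T))
      hW hWc hWfree (f.isOpenMap _ (f.isOpenMap _ hT))
      ((hTc.image f f.continuous.continuousOn).image f f.continuous.continuousOn)
      (by
        rintro _ ⟨_, ⟨u, hu, rfl⟩, rfl⟩ ⟨_, ⟨w, hw, rfl⟩, h⟩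
        exact hTfree u hu (f.injective (f.injective h) ▸ hw))
      (disjoint_right.2 (by
        rintro _ ⟨_, ⟨u, hu, rfl⟩, rfl⟩ h
        exact hAB.notMem_of_mem_left (hWA h) (hTB hu)))
      (a := f y) (b := f (f x)) (i := 1) (j := m + 1) (hKW (right_mem_segment ℝ x (f y)))
      ⟨f x, ⟨x, hxT, rfl⟩, rfl⟩ one_pos m.succ_pos
      ⟨f y, ⟨y, hKT (right_mem_segment ℝ x y), rfl⟩, rfl⟩
      (by
        rw [← Function.iterate_succ_apply, ← Function.iterate_succ_apply, hper]
        exact hxW)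
      (fun k hk hk1 => by omega)
      (fun k hk hkm => ⟨by
        rw [← Function.iterate_succ_apply, ← Function.iterate_succ_apply]
        exact hrec W hW hWc hWfree x hxW _ (by omega) (by omega), by
        rw [hiter]
        rintro ⟨_, ⟨w, hw, rfl⟩, h⟩
        exact hrec T hT hTc hTfree x hxT k hk (by omega) (f.injective (f.injective h) ▸ hw)⟩)
    exact ih (1 + (m + 1)) (by omega) (by omega) hF z hz

/-- Franks' lemma for two disjoint free domains. -/
theorem IsBrouwer.not_cycle {f : ℂ ≃ₜ ℂ} (hf : IsBrouwer f) {U V : Set ℂ}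
    (hU : IsOpen U) (hUc : IsPreconnected U) (hUfree : ∀ x ∈ U, f x ∉ U)
    (hV : IsOpen V) (hVc : IsPreconnected V) (hVfree : ∀ x ∈ V, f x ∉ V) (hUV : Disjoint U V)
    (h₁ : ∃ i, 0 < i ∧ ∃ a ∈ U, f^[i] a ∈ V) : ¬ ∃ j, 0 < j ∧ ∃ b ∈ V, f^[j] b ∈ U := by
  classical
  intro h₂
  have key : ∀ {U V : Set ℂ} (h : ∃ i, 0 < i ∧ ∃ a ∈ U, f^[i] a ∈ V), ∀ a ∈ U,
      f^[Nat.find h] a ∈ V → ∀ k, 0 < k → k < Nat.find h → f^[k] a ∉ U ∧ f^[k] a ∉ V := by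
    intro U V h a ha haV k hk hkh
    refine ⟨fun hkU => Nat.find_min h (m := Nat.find h - k) (by omega) ⟨by omega, _, hkU, ?_⟩,
      fun hkV => Nat.find_min h hkh ⟨hk, a, ha, hkV⟩⟩
    rwa [← Function.iterate_add_apply, Nat.sub_add_cancel hkh.le]
  obtain ⟨hi, a, ha, hai⟩ := Nat.find_spec h₁
  obtain ⟨hj, b, hb, hbj⟩ := Nat.find_spec h₂
  obtain ⟨F, hF, x, hx⟩ := hf.exists_periodic_of_cycle hU hUc hUfree hV hVc hVfree hUV ha hb hi hj
    hai hbj (key h₁ a ha hai) fun k hk hkj => (key h₂ b hb hbj k hk hkj).symm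
  exact hF.iterate_ne (by omega) x hx

theorem mem_interior_image_of_injOn {E : Type*} [NormedAddCommGroup E] [NormedSpace ℝ E]
    [ProperSpace E] (hE : 1 < Module.rank ℝ E) {g : E → ℂ}
    (hg : ContinuousOn g (Metric.closedBall 0 1)) (hinj : InjOn g (Metric.closedBall 0 1)) {p : E}
    (hp : ‖p‖ < 1) : g p ∈ interior (g '' Metric.closedBall 0 1) := by
  by_contra hint
  have hsb : Metric.sphere (0 : E) 1 ⊆ Metric.closedBall 0 1 := Metric.sphere_subset_closedBall
  have hpb : p ∈ Metric.closedBall (0 : E) 1 := by simpa using hp.le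
  have hgp : g p ∈ (g '' Metric.sphere 0 1)ᶜ := by
    rintro ⟨z, hz, hzp⟩
    rw [hinj (hsb hz) hpb hzp, mem_sphere_zero_iff_norm] at hz
    exact hp.ne hz
  obtain ⟨ε, hε, hball⟩ := Metric.isOpen_iff.1
    ((isCompact_sphere (0 : E) 1).image_of_continuousOn (hg.mono hsb)).isClosed.isOpen_compl _ hgp
  obtain ⟨c, hcε, hc⟩ : ∃ c ∈ Metric.ball (g p) ε, c ∉ g '' Metric.closedBall 0 1 := by
    by_contra! h
    exact hint (mem_interior.2 ⟨_, h, Metric.isOpen_ball, Metric.mem_ball_self hε⟩)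
  have hgS : Continuous fun z : Metric.sphere (0 : E) 1 => g z :=
    hg.comp_continuous continuous_subtype_val fun z => hsb z.2
  have hgpS : ∀ z : Metric.sphere (0 : E) 1, g z - g p ≠ 0 := fun z h =>
    hgp ⟨z, z.2, sub_eq_zero.1 h⟩
  have hcne : ∀ x ∈ Metric.closedBall (0 : E) 1, g x - c ≠ 0 := fun x hx h =>
    hc ⟨x, hx, sub_eq_zero.1 h⟩
  have hmem : ∀ (t : I) (z : Metric.sphere (0 : E) 1),
      (t : ℝ) • (z : E) ∈ Metric.closedBall (0 : E) 1 := fun t z => by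
    rw [mem_closedBall_zero_iff, norm_smul, norm_eq_of_mem_sphere, mul_one,
      Real.norm_of_nonneg t.2.1]
    exact t.2.2
  have hcont : Continuous fun x : I × Metric.sphere (0 : E) 1 => g ((x.1 : ℝ) • (x.2 : E)) :=
    hg.comp_continuous (by fun_prop) fun x => hmem x.1 x.2
  have hnorm : ∀ (t : I) (z : Metric.sphere (0 : E) 1),
      ‖(1 - t : ℝ) • p - (t : ℝ) • (z : E)‖ ≤ (1 - t) * ‖p‖ + t := fun t z => by
    refine (norm_sub_le _ _).trans_eq ?_
    rw [norm_smul, norm_smul, norm_eq_of_mem_sphere, mul_one, Real.norm_of_nonneg t.2.1,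
      Real.norm_of_nonneg (sub_nonneg.2 t.2.2)]
  have hmem' : ∀ (t : I) (z : Metric.sphere (0 : E) 1),
      (1 - t : ℝ) • p - (t : ℝ) • (z : E) ∈ Metric.closedBall (0 : E) 1 := fun t z => by
    rw [mem_closedBall_zero_iff]
    nlinarith [hnorm t z, t.2.2]
  have hcont' : Continuous fun x : I × Metric.sphere (0 : E) 1 =>
      g ((1 - x.1 : ℝ) • p - (x.1 : ℝ) • (x.2 : E)) :=
    hg.comp_continuous (by fun_prop) fun x => hmem' x.1 x.2
  have hne : ∀ (t : I) (z : Metric.sphere (0 : E) 1),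
      g z - g ((1 - t : ℝ) • p - (t : ℝ) • (z : E)) ≠ 0 := fun t z h => by
    have heq := hinj (hsb z.2) (hmem' t z) (sub_eq_zero.1 h)
    have h1 : (1 : ℝ) ≤ (1 - t) * ‖p‖ + t := by
      simpa [← heq] using hnorm t z
    have ht : (t : ℝ) = 1 := t.2.2.antisymm (by nlinarith)
    rw [ht, sub_self, zero_smul, zero_sub, one_smul] at heq
    exact ne_neg_of_mem_unit_sphere ℝ z (Subtype.ext heq)
  obtain ⟨L, hL, hLF, -⟩ := exists_log_homotopy
    (F := fun x : I × Metric.sphere (0 : E) 1 => g ((x.1 : ℝ) • (x.2 : E)) - c)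
    (hcont.sub continuous_const)
    (fun x => hcne _ (hmem x.1 x.2)) (l := fun _ => Complex.log (g 0 - c)) continuous_const
    (fun z => by
      rw [Complex.exp_log (hcne 0 (by simp))]
      simp)
  have hslit : ∀ z : Metric.sphere (0 : E) 1,
      1 + (g p - c) / (g z - g p) ∈ Complex.slitPlane := fun z => by
    refine Complex.mem_slitPlane_of_norm_lt_one ?_
    rw [norm_div, div_lt_one (norm_pos_iff.2 (hgpS z)), ← dist_eq_norm, ← dist_eq_norm, dist_comm]
    refine (Metric.mem_ball.1 hcε).trans_le ?_
    by_contra! h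
    exact hball h ⟨z, z.2, rfl⟩
  obtain ⟨M, hM, hMF, hM0⟩ := exists_log_homotopy
    (F := fun x : I × Metric.sphere (0 : E) 1 =>
      g x.2 - g ((1 - x.1 : ℝ) • p - (x.1 : ℝ) • (x.2 : E)))
    ((hgS.comp continuous_snd).sub hcont') (fun x => hne x.1 x.2)
    (l := fun z => L (1, z) - Complex.log (1 + (g p - c) / (g z - g p)))
    ((hL.comp (by fun_prop)).sub (Continuous.clog (continuous_const.add (continuous_const.div
      (hgS.sub continuous_const) hgpS)) hslit)) (fun z => by
      have h1 := hcne z (hsb z.2)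
      have h2 := hgpS z
      have h3 : 1 + (g p - c) / (g z - g p) = (g z - c) / (g z - g p) := by
        field_simp
        ring
      rw [Complex.exp_sub, hLF, Complex.exp_log (Complex.slitPlane_ne_zero (hslit z)), h3]
      simp [div_div_cancel₀ h1])
  have hanti : ∀ z, Complex.exp (M (1, -z) - M (1, z)) = -1 := fun z => by
    have h0 := Complex.exp_ne_zero (M (1, z))
    rw [Complex.exp_sub, div_eq_iff h0, hMF, hMF]
    simp
  have : PreconnectedSpace (Metric.sphere (0 : E) 1) :=
    Subtype.preconnectedSpace (isPreconnected_sphere hE 0 1)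
  have hconst : ∀ z w, M (1, -z) - M (1, z) = M (1, -w) - M (1, w) := fun z w =>
    eqOn_of_exp_eq (g := fun z => M (1, -z) - M (1, z)) isPreconnected_univ
      (Continuous.continuousOn (by fun_prop)) (fun x _ y _ => by rw [hanti, hanti]) (mem_univ z)
      (mem_univ w)
  have : Nontrivial E := by
    rw [← rank_pos_iff_nontrivial (R := ℝ)]
    exact zero_lt_one.trans hE
  obtain ⟨z, hz⟩ := NormedSpace.sphere_nonempty (x := (0 : E)) (r := 1) |>.2 zero_le_one
  have h1 := hconst (-⟨z, hz⟩) ⟨z, hz⟩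
  rw [neg_neg] at h1
  have h2 : M (1, -⟨z, hz⟩) - M (1, ⟨z, hz⟩) = 0 := by linear_combination -h1 / 2
  have h3 := hanti ⟨z, hz⟩
  rw [h2, Complex.exp_zero] at h3
  norm_num at h3

theorem isPreconnected_interior_of_homeomorph_closedBall {E : Type*} [NormedAddCommGroup E]
    [NormedSpace ℝ E] [ProperSpace E] (hE : 1 < Module.rank ℝ E) {K : Set ℂ}
    (φ : K ≃ₜ Metric.closedBall (0 : E) 1) : IsPreconnected (interior K) := by
  classical
  let g : E → ℂ := fun x => if h : x ∈ Metric.closedBall (0 : E) 1 then φ.symm ⟨x, h⟩ else 0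
  have hgφ : ∀ x : Metric.closedBall (0 : E) 1, g x = φ.symm x := fun x => dif_pos x.2
  have hg : ContinuousOn g (Metric.closedBall 0 1) := by
    rw [continuousOn_iff_continuous_domRestrict]
    exact (continuous_subtype_val.comp φ.symm.continuous).congr fun x => (hgφ x).symm
  have hinj : InjOn g (Metric.closedBall 0 1) := fun x hx y hy h => by
    have := (hgφ ⟨x, hx⟩).symm.trans (h.trans (hgφ ⟨y, hy⟩))
    exact congrArg Subtype.val (φ.symm.injective (Subtype.ext this))
  have himg : g '' Metric.closedBall 0 1 = K := by
    ext w
    constructor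
    · rintro ⟨x, hx, rfl⟩
      rw [hgφ ⟨x, hx⟩]
      exact Subtype.coe_prop _
    · intro hw
      exact ⟨φ ⟨w, hw⟩, Subtype.coe_prop _, by rw [hgφ, φ.symm_apply_apply]⟩
  refine ((convex_ball (0 : E) 1).isPreconnected.image g
    (hg.mono Metric.ball_subset_closedBall)).subset_closure ?_ (interior_subset.trans ?_)
  · rintro _ ⟨x, hx, rfl⟩
    rw [← himg]
    exact mem_interior_image_of_injOn hE hg hinj (mem_ball_zero_iff.1 hx)
  · have hcl := closure_ball (0 : E) one_ne_zero
    rw [← himg, ← hcl]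
    exact ContinuousOn.image_closure (hcl ▸ hg)

end

/-- The standard identification of `Plane` with `ℂ`. -/
noncomputable def planeHomeo : Plane ≃ₜ ℂ :=
  Complex.equivRealProdCLM.symm.toHomeomorph

theorem one_lt_rank_plane : 1 < Module.rank ℝ Plane := by
  rw [rank_prod', Module.rank_self, one_add_one_eq_two]
  exact Cardinal.one_lt_two

theorem IsClosedDisk.isPreconnected_interior {D : Set Plane} (hD : IsClosedDisk D) :
    IsPreconnected (interior D) := by
  obtain ⟨φ⟩ := hD
  rw [← planeHomeo.isPreconnected_image, planeHomeo.image_interior]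
  exact isPreconnected_interior_of_homeomorph_closedBall one_lt_rank_plane
    ((planeHomeo.image D).symm.trans φ)

/-- A Brouwer homeomorphism, read in the complex plane. -/
noncomputable def BrouwerHomeo.conj (h : BrouwerHomeo) : ℂ ≃ₜ ℂ :=
  planeHomeo.symm.trans (h.toHomeomorph.trans planeHomeo)

namespace BrouwerHomeo

variable (h : BrouwerHomeo)

theorem conj_planeHomeo (x : Plane) : h.conj (planeHomeo x) = planeHomeo (h.toHomeomorph x) := by
  simp [conj]

theorem isBrouwer_conj : IsBrouwer h.conj := by
  obtain ⟨H, hH, h0, h1⟩ := h.orientationPreserving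
  refine ⟨⟨fun t => planeHomeo.symm.trans ((H t).trans planeHomeo), ?_, ?_, ?_⟩, fun x hx => ?_⟩
  · exact planeHomeo.continuous.comp (hH.comp (f := fun p : ℝ × ℂ => (p.1, planeHomeo.symm p.2))
      (by fun_prop))
  · ext x
    simp [h0]
  · simp only [h1, conj]
  · obtain ⟨y, rfl⟩ := planeHomeo.surjective x
    rw [conj_planeHomeo] at hx
    exact h.fixedPointFree y (planeHomeo.injective hx)

theorem iter_add (m n : ℤ) (x : Plane) : h.iter (m + n) x = h.iter m (h.iter n x) := by
  simp [iter, zpow_add]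

theorem iter_one (x : Plane) : h.iter 1 x = h.toHomeomorph x := by
  simp [iter]

theorem iter_apply_comm (n : ℤ) (x : Plane) :
    h.toHomeomorph (h.iter n x) = h.iter n (h.toHomeomorph x) := by
  rw [← iter_one, ← iter_one, ← iter_add, ← iter_add, add_comm]

theorem iterate_conj (k : ℕ) (x : Plane) :
    h.conj^[k] (planeHomeo x) = planeHomeo (h.iter k x) := by
  induction k with
  | zero => simp [iter]
  | succ k ih =>
    rw [Function.iterate_succ_apply', ih, conj_planeHomeo, ← iter_one, ← iter_add, Nat.cast_succ,
      add_comm]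

theorem iterate_conj_toNat {m n : ℤ} (hmn : m ≤ n) (x : Plane) :
    h.conj^[(n - m).toNat] (planeHomeo (h.iter m x)) = planeHomeo (h.iter n x) := by
  rw [iterate_conj, ← iter_add, Int.toNat_of_nonneg (sub_nonneg.2 hmn), sub_add_cancel]

theorem iter_eq_zpow (n : ℤ) : h.iter n = ⇑(h.toHomeomorph ^ n) := by
  let toPerm : (Plane ≃ₜ Plane) →* Equiv.Perm Plane :=
    { toFun := Homeomorph.toEquiv, map_one' := rfl, map_mul' := fun _ _ => rfl }
  exact congrArg DFunLike.coe (map_zpow toPerm h.toHomeomorph n).symm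

theorem conj_notMem {E : Set Plane} (hE : IsFree h E) (n : ℤ) :
    ∀ x ∈ planeHomeo '' (h.iter n '' E), h.conj x ∉ planeHomeo '' (h.iter n '' E) := by
  rintro _ ⟨_, ⟨x, hx, rfl⟩, rfl⟩ ⟨_, ⟨y, hy, rfl⟩, hxy⟩
  rw [conj_planeHomeo, iter_apply_comm, planeHomeo.injective.eq_iff, iter_eq_zpow, (h.toHomeomorph ^ n).injective.eq_iff] at hxy
  exact disjoint_left.1 hE (mem_image_of_mem _ hx) (hxy ▸ hy)

end BrouwerHomeo

/-- For closed topological disks `D`, `V` with free interiors, the set of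
integers `n` such that `h^n(Int D)` meets `Int V` is an interval of `ℤ`. -/
theorem meeting_times_interval (h : BrouwerHomeo) (D V : Set Plane)
    (hD : IsClosedDisk D) (hV : IsClosedDisk V)
    (hDfree : IsFree h (interior D)) (hVfree : IsFree h (interior V)) :
    ∀ m m' n : ℤ,
      (h.iter m '' interior D ∩ interior V).Nonempty →
      (h.iter m' '' interior D ∩ interior V).Nonempty →
      m ≤ n → n ≤ m' →
      (h.iter n '' interior D ∩ interior V).Nonempty := by
  intro m m' n ⟨a, ⟨x, hx, hxa⟩, ha⟩ ⟨b, ⟨y, hy, hyb⟩, hb⟩ hmn hnm'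
  subst hxa hyb
  by_contra hempty
  have hne : ∀ d ∈ interior D, h.iter n d ∉ interior V := fun d hd hdV =>
    hempty ⟨_, ⟨d, hd, rfl⟩, hdV⟩
  have hmn : m < n := hmn.lt_of_ne (by rintro rfl; exact hne x hx ha)
  have hnm' : n < m' := hnm'.lt_of_ne (by rintro rfl; exact hne y hy hb)
  have hVfree := h.conj_notMem hVfree 0
  rw [show h.iter 0 = id from rfl, image_id] at hVfree
  refine h.isBrouwer_conj.not_cycle (U := planeHomeo '' (h.iter n '' interior D))
    (V := planeHomeo '' interior V) ?_ ?_ (h.conj_notMem hDfree n)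
    (planeHomeo.isOpenMap _ isOpen_interior) (planeHomeo.isPreconnected_image.2 hV.isPreconnected_interior) hVfree ?_
    ⟨(m' - n).toNat, by omega, _, ⟨_, ⟨y, hy, rfl⟩, rfl⟩, _, hb,
      (h.iterate_conj_toNat hnm'.le y).symm⟩
    ⟨(n - m).toNat, by omega, _, ⟨_, ha, rfl⟩, _, ⟨x, hx, rfl⟩,
      (h.iterate_conj_toNat hmn.le x).symm⟩
  · rw [h.iter_eq_zpow]
    exact planeHomeo.isOpenMap _ ((h.toHomeomorph ^ n).isOpenMap _ isOpen_interior)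
  · rw [h.iter_eq_zpow, planeHomeo.isPreconnected_image, Homeomorph.isPreconnected_image]
    exact hD.isPreconnected_interior
  · rw [disjoint_image_iff planeHomeo.injective, disjoint_left]
    rintro _ ⟨d, hd, rfl⟩
    exact hne d hd
end

section
/- Let h be a Brouwer homeomorphism. For every point x ∈ ℝ² and every compact set K ⊂ ℝ², there exists n₀ such that for all n ≥ n₀, h^n(x) ∉ K. In other words, the positive orbit of every point tends to infinity. -/
open Set Filter Topology

theorem Convex.exists_continuousOn_exp_eq {E : Type*} [NormedAddCommGroup E] [NormedSpace ℝ E]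
    {S : Set E} (hS : Convex ℝ S) (hne : S.Nonempty) (ho : IsOpen S) {f : E → ℂ}
    (hf : ContinuousOn f S) (h0 : ∀ x ∈ S, f x ≠ 0) :
    ∃ w : E → ℂ, ContinuousOn w S ∧ ∀ x ∈ S, Complex.exp (w x) = f x := by
  have := hS.contractibleSpace hne
  have hsc : IsSimplyConnected S := (inferInstance : SimplyConnectedSpace S)
  obtain ⟨w, hw, he⟩ := Complex.exists_continuousOn_eqOn_exp_comp hsc ho hf
    (by rintro ⟨x, hx, h⟩; exact h0 x hx h)
  exact ⟨w, hw, he⟩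

theorem IsPreconnected.eq_of_exp_eq {X : Type*} [TopologicalSpace X] {S : Set X}
    (hS : IsPreconnected S) {u : X → ℂ} (hu : ContinuousOn u S) {c : ℂ}
    (hc : ∀ x ∈ S, Complex.exp (u x) = c) {x y : X} (hx : x ∈ S) (hy : y ∈ S) : u x = u y :=
  Complex.isCoveringMap_exp.constOn_of_comp hS hu
    (fun a ha a' ha' => Subtype.ext ((hc a ha).trans (hc a' ha').symm)) hx hy

/-- A curve that a fixed-point-free map isotopic to the identity shifts by one unit of time does not
close up: comparing the turning of its secants with that of the displacement field along the first
closed loop would give that field a nonzero index. -/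
theorem not_closed_of_shift_eq {H : ℝ → ℂ → ℂ}
    (hH : Continuous fun p : ℝ × ℂ => H p.1 p.2) (hinj : ∀ τ, Function.Injective (H τ))
    (h0 : ∀ z, H 0 z = z) (hfix : ∀ z, H 1 z ≠ z) {γ : ℝ → ℂ} (hγ : Continuous γ)
    (hshift : ∀ s, γ (s + 1) = H 1 (γ s)) {a b : ℝ} (hab : a + 1 < b) (hclosed : γ a = γ b)
    (hsimple : ∀ s t, s < t → t < s + (b - a) → γ s ≠ γ t) : False := by
  obtain ⟨θ, hθ, hθe⟩ := convex_univ.exists_continuousOn_exp_eq univ_nonempty isOpen_univ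
    (f := fun z : ℂ => H 1 z - z) (by fun_prop) (fun z _ => sub_ne_zero.2 (hfix z))
  set S : Set (ℝ × ℝ × ℝ) := {p | p.1 < p.2.1 ∧ p.2.1 < p.1 + (b - a)} with hSdef
  have hSc : Convex ℝ S := by
    rintro ⟨s, t, τ⟩ ⟨h1, h2⟩ ⟨s', t', τ'⟩ ⟨h1', h2'⟩ x y hx hy hxy
    obtain rfl : y = 1 - x := by linarith
    simp only [hSdef, mem_ofPred_eq, Prod.smul_mk, Prod.mk_add_mk, smul_eq_mul] at *
    constructor
    · rcases hx.eq_or_lt with rfl | hx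
      · simpa using h1'
      · nlinarith
    · rcases hx.eq_or_lt with rfl | hx
      · simpa using h2'
      · nlinarith
  have hSo : IsOpen S :=
    IsOpen.and
      (isOpen_lt (f := fun p : ℝ × ℝ × ℝ => p.1) (g := fun p => p.2.1) (by fun_prop) (by fun_prop))
      (isOpen_lt (f := fun p : ℝ × ℝ × ℝ => p.2.1) (g := fun p => p.1 + (b - a)) (by fun_prop)
        (by fun_prop))
  obtain ⟨W, hW, hWe⟩ := hSc.exists_continuousOn_exp_eq
    ⟨(a, a + 1, 0), by constructor <;> dsimp only <;> linarith⟩ hSo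
    (f := fun p => H p.2.2 (γ p.2.1) - H p.2.2 (γ p.1)) (by fun_prop)
    (fun p hp => sub_ne_zero.2 fun h => hsimple _ _ hp.1 hp.2 (hinj _ h).symm)
  have hpos : ∀ s, W (s, s + 1, 0) - θ (γ s) = W (a, a + 1, 0) - θ (γ a) := fun s => by
    have hmem : ∀ s, (s, s + 1, (0 : ℝ)) ∈ S := fun s => by
      constructor <;> dsimp only <;> linarith
    refine isPreconnected_univ.eq_of_exp_eq (u := fun s => W (s, s + 1, 0) - θ (γ s)) (c := 1)
      (ContinuousOn.sub (hW.comp (by fun_prop) fun s _ => hmem s)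
        (hθ.comp hγ.continuousOn fun _ _ => mem_univ _)) (fun s _ => ?_)
      (mem_univ s) (mem_univ a)
    have := sub_ne_zero.2 (hfix (γ s))
    rw [Complex.exp_sub, hWe _ (hmem s), hθe _ (mem_univ _)]
    simp only [h0, hshift]
    exact div_self this
  have hturn : ∀ s t, s < t → t < s + (b - a) →
      W (s + 1, t + 1, 0) - W (s, t, 1) = W (a + 1, a + 1 + 1, 0) - W (a, a + 1, 1) :=
    fun s t h1 h2 => by
    have hmem : ∀ p : ℝ × ℝ × ℝ, p ∈ S → (p.1 + 1, p.2.1 + 1, (0 : ℝ)) ∈ S := fun p hp =>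
      ⟨by linarith [hp.1], by dsimp only; linarith [hp.2]⟩
    have hmem' : ∀ p : ℝ × ℝ × ℝ, p ∈ S → (p.1, p.2.1, (1 : ℝ)) ∈ S := fun p hp => hp
    refine hSc.isPreconnected.eq_of_exp_eq
      (u := fun p => W (p.1 + 1, p.2.1 + 1, 0) - W (p.1, p.2.1, 1)) (c := 1)
      (ContinuousOn.sub (hW.comp (by fun_prop) hmem) (hW.comp (by fun_prop) hmem'))
      (fun p hp => ?_) (x := (s, t, 0)) (y := (a, a + 1, 0)) ⟨h1, h2⟩
      ⟨by dsimp only; linarith, by dsimp only; linarith⟩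
    rw [Complex.exp_sub, hWe _ (hmem p hp), hWe _ (hmem' p hp)]
    simp only [h0, hshift]
    exact div_self (sub_ne_zero.2 fun h => hsimple _ _ hp.1 hp.2 (hinj _ h).symm)
  set Q : Set (ℝ × ℝ) := Ioo a b ×ˢ univ with hQ
  have hm1 : ∀ p : ℝ × ℝ, p ∈ Q → (p.1, b, p.2) ∈ S := fun p hp =>
    ⟨hp.1.2, by dsimp only; linarith [hp.1.1]⟩
  have hm2 : ∀ p : ℝ × ℝ, p ∈ Q → (a, p.1, p.2) ∈ S := fun p hp =>
    ⟨hp.1.1, by dsimp only; linarith [hp.1.2]⟩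
  have hQe : ∀ p ∈ Q, Complex.exp (W (p.1, b, p.2) - W (a, p.1, p.2)) = -1 := fun p hp => by
    rw [Complex.exp_sub, hWe _ (hm1 p hp), hWe _ (hm2 p hp)]
    simp only [← hclosed]
    have : H p.2 (γ p.1) - H p.2 (γ a) ≠ 0 :=
      sub_ne_zero.2 fun h => hsimple _ _ (hm2 p hp).1 (hm2 p hp).2 (hinj _ h).symm
    rw [← neg_sub, neg_div, div_self this]
  have hQc : ∀ s s' τ τ', s ∈ Ioo a b → s' ∈ Ioo a b →
      W (s, b, τ) - W (a, s, τ) = W (s', b, τ') - W (a, s', τ') := fun s s' τ τ' hs hs' =>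
    (isPreconnected_Ioo.prod isPreconnected_univ).eq_of_exp_eq
      (u := fun p : ℝ × ℝ => W (p.1, b, p.2) - W (a, p.1, p.2))
      (ContinuousOn.sub (hW.comp (by fun_prop) hm1) (hW.comp (by fun_prop) hm2)) hQe
      (x := (s, τ)) (y := (s', τ')) ⟨hs, mem_univ _⟩ ⟨hs', mem_univ _⟩
  have ha1 : a + 1 ∈ Ioo a b := ⟨by linarith, hab⟩
  have hb1 : b - 1 ∈ Ioo a b := ⟨by linarith, by linarith⟩
  have e1 := hpos b
  have e2 := hturn (b - 1) b (by linarith) (by linarith)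
  have e3 := hturn a (b - 1) (by linarith) (by linarith)
  have e4 := hQc (b - 1) (a + 1) 1 0 hb1 ha1
  have e5 := hQe (a + 1, 0) ⟨ha1, mem_univ _⟩
  rw [← hclosed] at e1
  rw [sub_add_cancel] at e2 e3
  have e6 : W (a + 1, b, 0) - W (a, a + 1, 0) = 0 := by linear_combination (e1 - e2 + e3 - e4) / 2
  simp [e6] at e5
  norm_num at e5

/-- The curve obtained by concatenating the images of an arc under the iterates of `g`. -/
noncomputable def orbitCurve (g : ℂ ≃ₜ ℂ) (α : ℝ → ℂ) (s : ℝ) : ℂ :=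
  (g ^ ⌊s⌋) (α (s - ⌊s⌋))

theorem orbitCurve_add_int (g : ℂ ≃ₜ ℂ) (α : ℝ → ℂ) (s : ℝ) (n : ℤ) :
    orbitCurve g α (s + n) = (g ^ n) (orbitCurve g α s) := by
  simp only [orbitCurve, Int.floor_add_intCast, Int.cast_add, add_sub_add_right_eq_sub]
  rw [add_comm, zpow_add]
  rfl

theorem orbitCurve_of_mem_Ico (g : ℂ ≃ₜ ℂ) (α : ℝ → ℂ) {s : ℝ} (hs : s ∈ Ico (0 : ℝ) 1) :
    orbitCurve g α s = α s := by
  simp [orbitCurve, Int.floor_eq_zero_iff.2 hs]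

theorem continuous_orbitCurve {g : ℂ ≃ₜ ℂ} {α : ℝ → ℂ} (hα : Continuous α)
    (h01 : α 1 = g (α 0)) : Continuous (orbitCurve g α) := by
  refine LocallyFinite.continuous (f := fun n : ℤ => Icc (n : ℝ) (n + 1))
    (locallyFinite_Icc_of_tendsto tendsto_intCast_atTop_atTop
      (tendsto_atBot_add_const_right _ _ (tendsto_intCast_atBot_iff.2 tendsto_id)))
    (iUnion_eq_univ_iff.2 fun s => ⟨⌊s⌋, Int.floor_le s, (Int.lt_floor_add_one s).le⟩)
    (fun _ => isClosed_Icc) fun n => ?_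
  have hc : Continuous fun s : ℝ => (g ^ n) (α (s - n)) :=
    (g ^ n).continuous.comp (hα.comp (by fun_prop))
  refine hc.continuousOn.congr fun s hs => ?_
  rcases hs.2.lt_or_eq with h | rfl
  · rw [orbitCurve, Int.floor_eq_iff.2 ⟨hs.1, h⟩]
  · have : orbitCurve g α 0 = α 0 := orbitCurve_of_mem_Ico g α ⟨le_rfl, zero_lt_one⟩
    have h := orbitCurve_add_int g α 0 (n + 1)
    push_cast at h
    rw [zero_add, this, zpow_add_one] at h
    simp only [h, add_sub_cancel_left, h01]
    rfl

/-- **Brouwer's lemma on translation arcs**, for the interior points of the arc. -/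
theorem zpow_image_ne_of_translation_arc {H : ℝ → ℂ ≃ₜ ℂ}
    (hH : Continuous fun p : ℝ × ℂ => H p.1 p.2) (h0 : ∀ z, H 0 z = z) (hfix : ∀ z, H 1 z ≠ z)
    {α : ℝ → ℂ} (hα : Continuous α) (h01 : α 1 = H 1 (α 0)) (hinj : InjOn α (Icc 0 1))
    (hfree : ∀ s ∈ Ico (0 : ℝ) 1, ∀ t ∈ Ico (0 : ℝ) 1, α s ≠ H 1 (α t))
    {s t : ℝ} (hs : s ∈ Ioo (0 : ℝ) 1) (ht : t ∈ Ioo (0 : ℝ) 1) {n : ℤ} (hn : 0 < n) :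
    ((H 1) ^ n) (α s) ≠ α t := by
  set γ := orbitCurve (H 1) α with hγdef
  have hγ : Continuous γ := continuous_orbitCurve hα h01
  have hshift : ∀ s, γ (s + 1) = H 1 (γ s) := fun s => by
    simpa using orbitCurve_add_int (H 1) α s 1
  have hfloor : ∀ s t, γ s = γ t → γ (s - ⌊s⌋) = γ (s - ⌊s⌋ + (t - s)) := fun s t h => by
    have h1 := orbitCurve_add_int (H 1) α s (-⌊s⌋)
    have h2 := orbitCurve_add_int (H 1) α t (-⌊s⌋)
    rw [← hγdef] at h1 h2
    push_cast at h1 h2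
    rw [sub_eq_add_neg s, h1, h, ← h2]
    congr 1
    ring
  have hIco : ∀ s ∈ Ico (0 : ℝ) 1, γ s = α s := fun s hs => orbitCurve_of_mem_Ico _ _ hs
  have hnear : ∀ s t, s < t → t ≤ s + 1 → γ s ≠ γ t := fun s t h1 h2 h => by
    have hs : s - ⌊s⌋ ∈ Ico (0 : ℝ) 1 := ⟨sub_nonneg.2 (Int.floor_le s), Int.fract_lt_one s⟩
    have h := hfloor s t h
    rw [hIco _ hs] at h
    set u := s - ⌊s⌋
    rcases lt_or_ge (u + (t - s)) 1 with hlt | hge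
    · have hu : u + (t - s) ∈ Ico (0 : ℝ) 1 := ⟨by linarith [hs.1], hlt⟩
      rw [hIco _ hu] at h
      linarith [hinj ⟨hs.1, hs.2.le⟩ ⟨hu.1, hu.2.le⟩ h]
    · have hu : u + (t - s) - 1 ∈ Ico (0 : ℝ) 1 := ⟨by linarith, by linarith [hs.2]⟩
      rw [← sub_add_cancel (u + (t - s)) 1, hshift, hIco _ hu] at h
      exact hfree _ hs _ hu h
  intro hst
  have hn1 : (1 : ℝ) ≤ n := by exact_mod_cast hn
  have hret : γ t = γ (s + n) := by
    rw [hγdef, orbitCurve_add_int, ← hγdef, hIco _ ⟨hs.1.le, hs.2⟩, hIco _ ⟨ht.1.le, ht.2⟩, hst]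
  set d := s + n - t with hd
  have hd1 : 1 ≤ d := by
    by_contra! hlt
    exact hnear t (s + n) (by linarith [hs.1, ht.2]) (by linarith) hret
  have hcpt : IsCompact (Icc (0 : ℝ) 1 ×ˢ Icc 1 d ∩ {p : ℝ × ℝ | γ p.1 = γ (p.1 + p.2)}) :=
    (isCompact_Icc.prod isCompact_Icc).inter_right (isClosed_eq (by fun_prop) (by fun_prop))
  obtain ⟨⟨a, T⟩, ⟨⟨-, hT1, hTd⟩, haT⟩, hmin⟩ := hcpt.exists_isMinOn
    ⟨(t, d), ⟨⟨⟨ht.1.le, ht.2.le⟩, hd1, le_rfl⟩, by simpa [hd] using hret⟩⟩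
    continuous_snd.continuousOn
  dsimp only at hT1 hTd
  have hT : 1 < T := by
    by_contra! hle
    exact hnear a (a + T) (by linarith) (by linarith) haT
  refine not_closed_of_shift_eq (H := fun τ z => H τ z) hH (fun τ => (H τ).injective) h0 hfix hγ
    hshift (a := a) (b := a + T) (by linarith) haT fun s t h1 h2 h => ?_
  have hfar : 1 ≤ t - s := by
    by_contra! hlt
    exact hnear s t h1 (by linarith) h
  have := hmin (a := (s - ⌊s⌋, t - s)) ⟨⟨⟨sub_nonneg.2 (Int.floor_le s),
    (Int.fract_lt_one s).le⟩, hfar, by dsimp only; linarith⟩, hfloor s t h⟩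
  simp only [mem_ofPred_eq] at this
  linarith

theorem exists_arc_of_lt {B : Set ℂ} (hB : Convex ℝ B) (ho : IsOpen B) {z₀ z₁ p q : ℂ}
    (h₀ : z₀ ∈ closure B) (h₁ : z₁ ∈ closure B) (hp : p ∈ B) (hq : q ∈ B) (l : ℂ →ₗ[ℝ] ℝ)
    (h0p : l z₀ < l p) (hpq : l p < l q) (hq1 : l q < l z₁) :
    ∃ α : ℝ → ℂ, Continuous α ∧ α 0 = z₀ ∧ α 1 = z₁ ∧ InjOn α (Icc 0 1) ∧
      (∀ s ∈ Ioo (0 : ℝ) 1, α s ∈ B) ∧ (∃ s ∈ Ioo (0 : ℝ) 1, α s = p) ∧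
      ∃ s ∈ Ioo (0 : ℝ) 1, α s = q := by
  set α : ℝ → ℂ := fun s => if s ≤ 1 / 3 then p + (1 - 3 * s) • (z₀ - p) else
    if s ≤ 2 / 3 then p + (3 * s - 1) • (q - p) else q + (3 * s - 2) • (z₁ - q) with hα
  have hmem : ∀ x ∈ B, ∀ z ∈ closure B, ∀ c : ℝ, 0 ≤ c → c < 1 → x + c • (z - x) ∈ B := by
    intro x hx z hz c h0 h1
    have := hB.combo_interior_closure_mem_interior (x := x) (y := z)
      (by rwa [ho.interior_eq]) hz (sub_pos.2 h1) h0 (sub_add_cancel _ _)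
    rw [ho.interior_eq] at this
    convert this using 1
    module
  refine ⟨α, ?_, ?_, ?_, ?_, ?_, ⟨1 / 3, by norm_num, ?_⟩, ⟨2 / 3, by norm_num, ?_⟩⟩
  · refine Continuous.if_le (by fun_prop) (Continuous.if_le (by fun_prop) (by fun_prop)
      (by fun_prop) (by fun_prop) ?_) (by fun_prop) (by fun_prop) ?_
    · rintro s rfl
      norm_num
    · rintro s rfl
      norm_num
  · norm_num [hα]
  · norm_num [hα]
  · have hmono : StrictMono fun s => l (α s) := by
      intro s t hst
      simp only [hα]
      split_ifs <;> simp only [map_add, map_smul, map_sub, smul_eq_mul] <;> nlinarith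
    exact fun s _ t _ h => hmono.injective (congrArg l h)
  · rintro s ⟨hs0, hs1⟩
    simp only [hα]
    split_ifs
    · exact hmem _ hp _ h₀ _ (by linarith) (by linarith)
    · rcases eq_or_lt_of_le ‹s ≤ 2 / 3› with rfl | h
      · norm_num [hq]
      · exact hmem _ hp _ (subset_closure hq) _ (by linarith) (by linarith)
    · exact hmem _ hq _ h₁ _ (by linarith) (by linarith)
  · norm_num [hα]
  · norm_num [hα]

theorem exists_arc_ball {y z₀ z₁ p q : ℂ} {r : ℝ} (h₀ : ‖z₀ - y‖ = r) (h₁ : ‖z₁ - y‖ = r)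
    (hp : ‖p - y‖ < ‖z₁ - z₀‖ / 2) (hq : ‖q - y‖ < ‖z₁ - z₀‖ / 2) :
    ∃ α : ℝ → ℂ, Continuous α ∧ α 0 = z₀ ∧ α 1 = z₁ ∧ InjOn α (Icc 0 1) ∧
      (∀ s ∈ Ioo (0 : ℝ) 1, α s ∈ Metric.ball y r) ∧ (∃ s ∈ Ioo (0 : ℝ) 1, α s = p) ∧
      ∃ s ∈ Ioo (0 : ℝ) 1, α s = q := by
  wlog hne : p ≠ q generalizing q
  · have hev : ∀ᶠ x in 𝓝[≠] p, ‖x - y‖ < ‖z₁ - z₀‖ / 2 ∧ x ≠ p :=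
      ((ContinuousAt.eventually_lt (by fun_prop) (by fun_prop) hp).filter_mono
        nhdsWithin_le_nhds).and self_mem_nhdsWithin
    obtain ⟨q', hq', hne'⟩ := hev.exists
    obtain ⟨α, hc, h0, h1, hi, hb, hαp, -⟩ := this hq' hne'.symm
    exact ⟨α, hc, h0, h1, hi, hb, hαp, (not_not.1 hne) ▸ hαp⟩
  have hle : ‖z₁ - z₀‖ ≤ 2 * r := by
    calc ‖z₁ - z₀‖ = ‖(z₁ - y) - (z₀ - y)‖ := by congr 1; ring
      _ ≤ ‖z₁ - y‖ + ‖z₀ - y‖ := norm_sub_le _ _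
      _ = 2 * r := by rw [h₀, h₁]; ring
  have hpB : p ∈ Metric.ball y r := mem_ball_iff_norm.2 (by linarith)
  have hqB : q ∈ Metric.ball y r := mem_ball_iff_norm.2 (by linarith)
  have hr : r ≠ 0 := (Metric.pos_of_mem_ball hpB).ne'
  have hz₀ : z₀ ∈ closure (Metric.ball y r) := by
    rw [closure_ball y hr]; exact mem_closedBall_iff_norm.2 h₀.le
  have hz₁ : z₁ ∈ closure (Metric.ball y r) := by
    rw [closure_ball y hr]; exact mem_closedBall_iff_norm.2 h₁.le
  have hN : 0 < ‖z₁ - z₀‖ := by linarith [norm_nonneg (p - y)]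
  have hhalf : ∀ x : ℂ, ‖x - y‖ < ‖z₁ - z₀‖ / 2 →
      inner ℝ (z₁ - z₀) z₀ < inner ℝ (z₁ - z₀) x ∧ inner ℝ (z₁ - z₀) x < inner ℝ (z₁ - z₀) z₁ := by
    intro x hx
    have hsq : inner ℝ (z₁ - z₀) ((z₁ - y) + (z₀ - y)) = 0 := by
      rw [show z₁ - z₀ = (z₁ - y) - (z₀ - y) by ring, inner_sub_left, inner_add_right,
        inner_add_right, real_inner_self_eq_norm_sq, real_inner_self_eq_norm_sq, h₀, h₁,
        real_inner_comm (z₁ - y)]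
      ring
    have hself := real_inner_self_eq_norm_sq (z₁ - z₀)
    have habs := abs_le.1 (abs_real_inner_le_norm (z₁ - z₀) (x - y))
    have hlt : ‖z₁ - z₀‖ * ‖x - y‖ < ‖z₁ - z₀‖ ^ 2 / 2 := by nlinarith
    rw [inner_add_right] at hsq
    rw [inner_sub_right] at hself
    simp only [inner_sub_right] at hsq hself habs
    constructor <;> linarith [habs.1, habs.2]
  obtain ⟨v, hv, hvp, hvq⟩ : ∃ v : ℂ, inner ℝ v p ≠ inner ℝ v q ∧
      (inner ℝ v z₀ < inner ℝ v p ∧ inner ℝ v p < inner ℝ v z₁) ∧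
      (inner ℝ v z₀ < inner ℝ v q ∧ inner ℝ v q < inner ℝ v z₁) := by
    by_cases hv : inner ℝ (z₁ - z₀) p = inner ℝ (z₁ - z₀) q
    · have hev : ∀ x x' : ℂ, inner ℝ (z₁ - z₀) x < inner ℝ (z₁ - z₀) x' → ∀ᶠ e : ℝ in 𝓝[≠] 0,
          inner ℝ (z₁ - z₀ + e • (p - q)) x < inner ℝ (z₁ - z₀ + e • (p - q)) x' :=
        fun x x' h => (ContinuousAt.eventually_lt (by fun_prop) (by fun_prop)
          (by simpa using h)).filter_mono nhdsWithin_le_nhds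
      obtain ⟨e, ⟨h1, h2⟩, ⟨h3, h4⟩, he⟩ := (((hev _ _ (hhalf p hp).1).and
        (hev _ _ (hhalf p hp).2)).and (((hev _ _ (hhalf q hq).1).and (hev _ _ (hhalf q hq).2)).and
        self_mem_nhdsWithin)).exists
      refine ⟨_, fun h => ?_, ⟨h1, h2⟩, h3, h4⟩
      have hz : inner ℝ (z₁ - z₀ + e • (p - q)) (p - q) = 0 := by
        rw [inner_sub_right, h, sub_self]
      rw [inner_add_left, inner_sub_right, hv, sub_self, zero_add, inner_smul_left] at hz
      simp only [conj_trivial, mul_eq_zero, inner_self_eq_zero, sub_eq_zero] at hz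
      exact hz.elim he hne
    · exact ⟨_, hv, hhalf p hp, hhalf q hq⟩
  rcases hv.lt_or_gt with h | h
  · exact exists_arc_of_lt (convex_ball y r) Metric.isOpen_ball hz₀ hz₁ hpB hqB
      (innerSL ℝ v).toLinearMap hvp.1 h hvq.2
  · obtain ⟨α, hc, h0, h1, hi, hb, hαq, hαp⟩ := exists_arc_of_lt (convex_ball y r)
      Metric.isOpen_ball hz₀ hz₁ hqB hpB (innerSL ℝ v).toLinearMap hvq.1 h hvp.2
    exact ⟨α, hc, h0, h1, hi, hb, hαp, hαq⟩

theorem exists_maximal_free_ball (g : ℂ ≃ₜ ℂ) (y : ℂ) :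
    ∃ r z, ‖z - y‖ = r ∧ ‖g z - y‖ = r ∧
      ∀ w ∈ Metric.ball y r, g w ∉ Metric.closedBall y r := by
  have hF : Continuous fun z => max ‖z - y‖ ‖g z - y‖ := by
    have := g.continuous
    fun_prop
  obtain ⟨z, hz⟩ := hF.exists_forall_le (tendsto_atTop_mono (fun z => le_max_left _ _)
    (by simpa only [dist_eq_norm] using tendsto_dist_right_cocompact_atTop y))
  set r := max ‖z - y‖ ‖g z - y‖ with hr
  have hfree : ∀ w ∈ Metric.ball y r, g w ∉ Metric.ball y r := fun w h1 h2 =>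
    (hz w).not_gt (max_lt (mem_ball_iff_norm.1 h1) (mem_ball_iff_norm.1 h2))
  have hcl : ∀ w ∈ Metric.ball y r, g w ∉ Metric.closedBall y r := fun w h1 h2 => by
    rw [← closure_ball y (Metric.pos_of_mem_ball h1).ne'] at h2
    obtain ⟨_, ⟨u, hu, rfl⟩, hgu⟩ := (mem_closure_iff_nhds.1 h2) _
      ((g.isOpenMap _ Metric.isOpen_ball).mem_nhds (mem_image_of_mem g h1))
    exact hfree u hu hgu
  have hzr : ‖z - y‖ ≤ r := le_max_left _ _
  have hgr : ‖g z - y‖ ≤ r := le_max_right _ _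
  refine ⟨r, z, hzr.antisymm (not_lt.1 fun h => ?_), hgr.antisymm (not_lt.1 fun h => ?_), hcl⟩
  · exact hcl z (mem_ball_iff_norm.2 h) (mem_closedBall_iff_norm.2 hgr)
  · have hgz : g z ∈ Metric.ball y r := mem_ball_iff_norm.2 h
    have hzc := mem_closedBall_iff_norm.2 hzr
    rw [← closure_ball y (Metric.pos_of_mem_ball hgz).ne'] at hzc
    obtain ⟨u, hgu, hu⟩ := (mem_closure_iff_nhds.1 hzc) _
      ((Metric.isOpen_ball.preimage g.continuous).mem_nhds hgz)
    exact hfree u hu hgu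

theorem not_mapClusterPt_orbit {H : ℝ → ℂ ≃ₜ ℂ}
    (hH : Continuous fun p : ℝ × ℂ => H p.1 p.2) (h0 : ∀ z, H 0 z = z) (hfix : ∀ z, H 1 z ≠ z)
    (x y : ℂ) : ¬ MapClusterPt y atTop fun n : ℕ => ((H 1) ^ (n : ℤ)) x := by
  intro hy
  obtain ⟨r, z, h₀, h₁, hfree⟩ := exists_maximal_free_ball (H 1) y
  have hfreq := hy.frequently (p := fun p => ‖p - y‖ < ‖H 1 z - z‖ / 2)
    (ContinuousAt.eventually_lt (by fun_prop) (by fun_prop)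
      (by simpa [sub_eq_zero] using hfix z))
  obtain ⟨i, -, hi⟩ := frequently_atTop.1 hfreq 0
  obtain ⟨j, hij, hj⟩ := frequently_atTop.1 hfreq (i + 1)
  obtain ⟨α, hα, hα0, hα1, hinj, hball, ⟨s, hs, hsp⟩, t, ht, htq⟩ := exists_arc_ball h₀ h₁ hi hj
  have hclosed : ∀ s ∈ Ico (0 : ℝ) 1, α s ∈ Metric.closedBall y r := fun s hs => by
    rcases hs.1.eq_or_lt with rfl | h
    · rw [hα0]
      exact mem_closedBall_iff_norm.2 h₀.le
    · exact Metric.ball_subset_closedBall (hball s ⟨h, hs.2⟩)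
  refine zpow_image_ne_of_translation_arc hH h0 hfix hα (by rw [hα0, hα1]) hinj
    (fun s hs t ht h => ?_) hs ht (n := (j : ℤ) - i) (by omega) ?_
  · rcases ht.1.eq_or_lt with rfl | h0t
    · rw [hα0, ← hα1] at h
      exact hs.2.ne (hinj ⟨hs.1, hs.2.le⟩ ⟨zero_le_one, le_rfl⟩ h)
    · exact hfree _ (hball t ⟨h0t, ht.2⟩) (h ▸ hclosed s hs)
  · rw [hsp, htq, ← Homeomorph.mul_apply, ← zpow_add, sub_add_cancel]

/-- The positive orbit of every point tends to infinity: it eventually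
leaves every compact set. -/
theorem positive_orbit_tends_to_infinity (h : BrouwerHomeo) :
    ∀ x : Plane, ∀ K : Set Plane, IsCompact K →
      ∃ n₀ : ℕ, ∀ n : ℕ, n₀ ≤ n → h.iter n x ∉ K := by
  intro x K hK
  by_contra! hrec
  obtain ⟨H, hH, hH0, hH1⟩ := h.orientationPreserving
  have hfreq : ∃ᶠ n : ℕ in atTop, h.iter n x ∈ K := frequently_atTop.2 hrec
  obtain ⟨y, -, hy⟩ := hK.exists_mapClusterPt_of_frequently hfreq
  let e : Plane ≃ₜ ℂ := Complex.equivRealProdCLM.symm.toHomeomorph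
  let G : ℝ → ℂ ≃ₜ ℂ := fun τ => (e.symm.trans (H τ)).trans e
  have hG1 : ∀ z, G 1 (e z) = e (h.toHomeomorph z) := fun z => by simp [G, hH1]
  have hiter : ∀ (n : ℕ) (z : Plane), (G 1 ^ (n : ℤ)) (e z) = e (h.iter n z) := fun n => by
    induction n with
    | zero => intro z; rfl
    | succ n ih =>
      intro z
      simp only [BrouwerHomeo.iter, Nat.cast_succ, zpow_add_one] at ih ⊢
      rw [Homeomorph.mul_apply, hG1, ih]
      rfl
  refine not_mapClusterPt_orbit (H := G) ?_ (fun z => by simp [G, hH0]) (fun z hz => ?_) (e x) (e y)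
    ?_
  · exact e.continuous.comp (hH.comp (continuous_fst.prodMk (e.symm.continuous.comp continuous_snd)))
  · obtain ⟨z, rfl⟩ := e.surjective z
    exact h.fixedPointFree z (e.injective ((hG1 z).symm.trans hz))
  · simpa only [hiter, Function.comp_def] using hy.continuousAt_comp e.continuous.continuousAt
end
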